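/- arXiv:1804.07989 — 4 statements merged into one kernel-verified Lean document; each statement's English description precedes it below -/
import Mathlib

section
/- For every integer n ≥ 2, the A-elliptic multiple zeta value of the (n+1)-tuple (0,…,0,1,0), consisting of n−1 zeros followed by 1 followed by 0, satisfies: A(0,…,0,1,0;τ) → −2πi·n·ζ^{odd}(n) − Σ_{j=2}^{n−2} ((n−j)/j!)·(2πi)^j·ζ^{odd}(n+1−j) as Im τ → ∞ (uniformly in Re τ), where ζ^{odd}(k) = ζ(k) if k is odd and ζ^{odd}(k) = 0 if k is even. -/
open scoped Real Nat
open Finset MeasureTheory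

/-- The coefficients `f_n(ξ,τ)` of the expansion of the Kronecker function:
`f₀ = 2πi`, `f₁(ξ,τ) = π cot(πξ) − 2πi Σ_{m,p≥1}(e^{2πimξ} − e^{−2πimξ}) q^{mp}` and, for
`n ≥ 2`, `f_n(ξ,τ) = (2πi/(n−1)!)(Bₙ/n − Σ_{m,p≥1}(e^{2πimξ} + (−1)ⁿ e^{−2πimξ}) p^{n−1} q^{mp})`
(Bernoulli numbers with `B₁ = −1/2`). -/
noncomputable def fKr : ℕ → ℂ → ℂ → ℂ
  | 0, _, _ => 2 * ↑π * Complex.I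
  | 1, ξ, τ =>
      ↑π * Complex.cot (↑π * ξ) -
        2 * ↑π * Complex.I *
          ∑' mp : ℕ × ℕ,
            (Complex.exp (2 * ↑π * Complex.I * ((mp.1 : ℂ) + 1) * ξ) -
                Complex.exp (-(2 * ↑π * Complex.I * ((mp.1 : ℂ) + 1) * ξ))) *
              Complex.exp (2 * ↑π * Complex.I * τ) ^ ((mp.1 + 1) * (mp.2 + 1))
  | (n + 2), ξ, τ =>
      (2 * ↑π * Complex.I / ((n + 1)! : ℂ)) *
        ((bernoulli (n + 2) : ℂ) / ((n : ℂ) + 2) -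
          ∑' mp : ℕ × ℕ,
            (Complex.exp (2 * ↑π * Complex.I * ((mp.1 : ℂ) + 1) * ξ) +
                (-1 : ℂ) ^ (n + 2) *
                  Complex.exp (-(2 * ↑π * Complex.I * ((mp.1 : ℂ) + 1) * ξ))) *
              ((mp.2 : ℂ) + 1) ^ (n + 1) *
              Complex.exp (2 * ↑π * Complex.I * τ) ^ ((mp.1 + 1) * (mp.2 + 1)))

/-- `ω_n(ξ,τ) = Σ_{k=0}^{n} ((Im ξ/Im τ)^k / k!) · f_{n−k}(ξ,τ)`. -/
noncomputable def omKr (n : ℕ) (ξ τ : ℂ) : ℂ :=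
  ∑ k ∈ Finset.range (n + 1),
    (((ξ.im / τ.im) ^ k / (k ! : ℝ) : ℝ) : ℂ) * fKr (n - k) ξ τ

/-- The open simplex `{1 > t₁ > ⋯ > t_r > 0}` in `(Fin r → ℝ)`. -/
def openSimplex (r : ℕ) : Set (Fin r → ℝ) :=
  {t | (∀ i, 0 < t i ∧ t i < 1) ∧ ∀ i j : Fin r, i < j → t j < t i}

/-- The A-elliptic multiple zeta value
`A(n₁,…,n_r;τ) = ∫_{1>t₁>⋯>t_r>0} f_{n₁}(t₁,τ)⋯f_{n_r}(t_r,τ) dt`. -/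
noncomputable def Aell {r : ℕ} (n : Fin r → ℕ) (τ : ℂ) : ℂ :=
  ∫ t in openSimplex r, ∏ i, fKr (n i) ((t i : ℝ) : ℂ) τ

/-- The B-elliptic multiple zeta value
`B(n₁,…,n_r;τ) = τ^{n₁+⋯+n_r} ∫_{1>t₁>⋯>t_r>0} ω_{n₁}(τt₁,τ)⋯ω_{n_r}(τt_r,τ) dt`. -/
noncomputable def Bell {r : ℕ} (n : Fin r → ℕ) (τ : ℂ) : ℂ :=
  τ ^ (∑ i, n i) * ∫ t in openSimplex r, ∏ i, omKr (n i) (τ * ((t i : ℝ) : ℂ)) τ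

/-- `ζ^{odd}(k) = ζ(k)` if `k` is odd, `0` otherwise. -/
noncomputable def zetaOdd (k : ℕ) : ℂ :=
  if Odd k then riemannZeta (k : ℂ) else 0

/-- The open simplex `{1 > t₁ > ⋯ > t_r > a}` in `(Fin r → ℝ)`. -/
def upperSimplex (r : ℕ) (a : ℝ) : Set (Fin r → ℝ) :=
  {t | (∀ i, a < t i ∧ t i < 1) ∧ ∀ i j : Fin r, i < j → t j < t i}

lemma measurableSet_upperSimplex (r : ℕ) (a : ℝ) : MeasurableSet (upperSimplex r a) := by
  unfold upperSimplex
  measurability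

lemma snoc_mem_upperSimplex {r : ℕ} {a x : ℝ} {s : Fin r → ℝ} :
    (Fin.snoc s x : Fin (r + 1) → ℝ) ∈ upperSimplex (r + 1) a ↔
      x ∈ Set.Ioo a 1 ∧ s ∈ upperSimplex r x := by
  simp only [upperSimplex, Set.mem_ofPred_eq, Set.mem_Ioo, Fin.forall_fin_succ', Fin.snoc_castSucc,
    Fin.snoc_last, Fin.castSucc_lt_castSucc_iff, lt_irrefl, false_imp_iff, and_true,
    Fin.castSucc_lt_last, true_imp_iff, Fin.not_lt.2 (Fin.le_last _)]
  constructor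
  · rintro ⟨⟨h1, h2⟩, h3, -⟩
    exact ⟨h2, fun i => ⟨(h3 i).2, (h1 i).2⟩, fun i => (h3 i).1⟩
  · rintro ⟨h2, h1, h3⟩
    exact ⟨⟨fun i => ⟨h2.1.trans (h1 i).1, (h1 i).2⟩, h2⟩, fun i => ⟨h3 i, (h1 i).1⟩, by simp⟩

lemma lintegral_upperSimplex_succ {r : ℕ} (a : ℝ) {F : (Fin (r + 1) → ℝ) → ENNReal}
    (hF : Measurable F) :
    ∫⁻ t in upperSimplex (r + 1) a, F t =
      ∫⁻ x in Set.Ioo a 1, ∫⁻ s in upperSimplex r x, F (Fin.snoc s x) := by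
  rw [← lintegral_indicator (measurableSet_upperSimplex _ _),
    ← lintegral_indicator measurableSet_Ioo]
  have hmp := (volume_preserving_piFinSuccAbove (fun _ : Fin (r + 1) => ℝ) (Fin.last r)).symm
  have hG := hF.indicator (measurableSet_upperSimplex (r + 1) a)
  rw [← hmp.lintegral_comp hG, Measure.volume_eq_prod]
  refine (lintegral_prod _ (hG.comp hmp.measurable).aemeasurable).trans
    (lintegral_congr fun x => ?_)
  simp only [Function.comp_apply]
  have key : ∀ s : Fin r → ℝ, (MeasurableEquiv.piFinSuccAbove (fun _ : Fin (r + 1) => ℝ)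
      (Fin.last r)).symm (x, s) = (Fin.snoc s x : Fin (r + 1) → ℝ) := fun s => by
    simp only [MeasurableEquiv.piFinSuccAbove, MeasurableEquiv.symm_mk, MeasurableEquiv.coe_mk,
      Equiv.symm_symm, Fin.insertNthEquiv_last]
    rfl
  simp only [key]
  by_cases hx : x ∈ Set.Ioo a 1
  · rw [Set.indicator_of_mem hx, ← lintegral_indicator (measurableSet_upperSimplex _ _)]
    refine lintegral_congr fun s => ?_
    by_cases hs : s ∈ upperSimplex r x
    · rw [Set.indicator_of_mem hs, Set.indicator_of_mem (snoc_mem_upperSimplex.2 ⟨hx, hs⟩)]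
    · rw [Set.indicator_of_notMem hs,
        Set.indicator_of_notMem fun h => hs (snoc_mem_upperSimplex.1 h).2]
  · rw [Set.indicator_of_notMem hx]
    simp [Set.indicator, snoc_mem_upperSimplex, hx]

lemma volume_upperSimplex (r : ℕ) {a : ℝ} (ha : a ≤ 1) :
    volume (upperSimplex r a) = ENNReal.ofReal ((1 - a) ^ r / r !) := by
  induction r generalizing a with
  | zero =>
    have : upperSimplex 0 a = Set.univ := by ext; simp [upperSimplex]
    simp [this, volume_pi]
  | succ r ih =>
    have h := lintegral_upperSimplex_succ (r := r) a (F := fun _ => 1) measurable_const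
    simp only [lintegral_const, one_mul, Measure.restrict_apply_univ] at h
    rw [h, setLIntegral_congr_fun (g := fun x => ENNReal.ofReal ((1 - x) ^ r / r !))
      measurableSet_Ioo fun x hx => ih hx.2.le, ← ofReal_integral_eq_lintegral_ofReal]
    · congr 1
      rw [← integral_Ioc_eq_integral_Ioo, ← intervalIntegral.integral_of_le ha,
        intervalIntegral.integral_comp_sub_left (fun x => x ^ r / (r ! : ℝ)) 1]
      simp [Nat.factorial_succ]
      field_simp
    · exact (Continuous.integrableOn_Icc (by fun_prop)).mono_set Set.Ioo_subset_Icc_self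
    · refine (ae_restrict_iff' measurableSet_Ioo).2 (.of_forall fun x hx => ?_)
      have : 0 ≤ 1 - x := by linarith [hx.2]
      simp only [Pi.zero_apply]
      positivity

/-- The distribution of the last but one coordinate on the simplex. -/
lemma map_openSimplex_penultimate (m : ℕ) :
    (volume.restrict (openSimplex (m + 2))).map (fun t => t (Fin.last m).castSucc) =
      (volume.restrict (Set.Ioo (0 : ℝ) 1)).withDensity
        fun x => ENNReal.ofReal (x * ((1 - x) ^ m / m !)) := by
  refine Measure.ext_of_lintegral _ fun G hG => ?_
  rw [lintegral_map hG (by fun_prop), lintegral_withDensity_eq_lintegral_mul _ (by fun_prop) hG]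
  change ∫⁻ t in upperSimplex (m + 2) 0, _ = _
  rw [lintegral_upperSimplex_succ _ (by fun_prop)]
  simp only [Fin.snoc_castSucc]
  have h1 : ∀ y ∈ Set.Ioo (0 : ℝ) 1,
      ∫⁻ s in upperSimplex (m + 1) y, G (s (Fin.last m)) =
        ∫⁻ x in Set.Ioo (0 : ℝ) 1, (Set.Ioi y).indicator
          (fun x => G x * ENNReal.ofReal ((1 - x) ^ m / m !)) x := fun y hy => by
    rw [lintegral_upperSimplex_succ _ (by fun_prop),
      setLIntegral_indicator measurableSet_Ioi,
      show Set.Ioi y ∩ Set.Ioo 0 1 = Set.Ioo y 1 by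
        ext z; simp only [Set.mem_inter_iff, Set.mem_Ioi, Set.mem_Ioo]; grind]
    refine setLIntegral_congr_fun measurableSet_Ioo fun x hx => ?_
    simp only [Fin.snoc_last, lintegral_const, Measure.restrict_apply_univ,
      volume_upperSimplex m hx.2.le]
  rw [setLIntegral_congr_fun measurableSet_Ioo h1, lintegral_lintegral_swap]
  · refine setLIntegral_congr_fun measurableSet_Ioo fun x hx => ?_
    have : ∀ y, (Set.Ioi y).indicator (fun x => G x * ENNReal.ofReal ((1 - x) ^ m / m !)) x =
        (Set.Iio x).indicator (fun _ => G x * ENNReal.ofReal ((1 - x) ^ m / m !)) y := fun y => by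
      simp [Set.indicator]
    simp only [this]
    rw [setLIntegral_indicator measurableSet_Iio,
      show Set.Iio x ∩ Set.Ioo 0 1 = Set.Ioo 0 x by
        ext z; simp only [Set.mem_inter_iff, Set.mem_Iio, Set.mem_Ioo]; grind]
    simp only [lintegral_const, Measure.restrict_apply_univ, Real.volume_Ioo, sub_zero,
      Pi.mul_apply]
    rw [ENNReal.ofReal_mul hx.1.le]
    ring
  · have : (Function.uncurry fun y x => (Set.Ioi y).indicator
        (fun x => G x * ENNReal.ofReal ((1 - x) ^ m / m !)) x) =
        {p : ℝ × ℝ | p.1 < p.2}.indicator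
          fun p => G p.2 * ENNReal.ofReal ((1 - p.2) ^ m / m !) := by
      ext p; simp [Set.indicator, Function.uncurry]
    rw [this]
    exact (Measurable.indicator (by fun_prop)
      (measurableSet_lt measurable_fst measurable_snd)).aemeasurable

lemma integral_openSimplex_penultimate (m : ℕ) {g : ℝ → ℂ} (hg : Measurable g) :
    ∫ t in openSimplex (m + 2), g (t (Fin.last m).castSucc) =
      ∫ x in Set.Ioo (0 : ℝ) 1, ((x * ((1 - x) ^ m / m !) : ℝ) : ℂ) * g x := by
  have hmeas : Measurable fun t : Fin (m + 2) → ℝ => t (Fin.last m).castSucc := by fun_prop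
  rw [← integral_map (f := g) hmeas.aemeasurable hg.aestronglyMeasurable, map_openSimplex_penultimate,
    integral_withDensity_eq_integral_toReal_smul (by fun_prop) (by simp)]
  refine setIntegral_congr_fun measurableSet_Ioo fun x hx => ?_
  have : 0 ≤ 1 - x := by linarith [hx.2]
  have := hx.1
  simp only [ENNReal.toReal_ofReal (show 0 ≤ x * ((1 - x) ^ m / (m ! : ℝ)) by positivity)]
  exact Complex.real_smul

lemma integral_simplex_mul_exp (m : ℕ) {k : ℤ} (hk : k ≠ 0) :
    (2 * π * Complex.I) ^ (m + 1) *
        ∫ t in (0 : ℝ)..1, (1 - t : ℂ) ^ m / m ! * Complex.exp (2 * π * Complex.I * k * t) =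
      -∑ j ∈ range m, (2 * π * Complex.I) ^ (j + 1) / (j + 1)! / (k : ℂ) ^ (m - j) := by
  have hc : (2 * π * Complex.I : ℂ) ≠ 0 := Complex.two_pi_I_ne_zero
  have hk' : (k : ℂ) ≠ 0 := by exact_mod_cast hk
  have hck : 2 * π * Complex.I * (k : ℂ) ≠ 0 := mul_ne_zero hc hk'
  have hexp : Complex.exp (2 * π * Complex.I * k) = 1 := by
    rw [mul_comm]; exact Complex.exp_int_mul_two_pi_mul_I k
  have hd : ∀ t : ℝ, HasDerivAt
      (fun t : ℝ => Complex.exp (2 * π * Complex.I * k * t) / (2 * π * Complex.I * k))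
      (Complex.exp (2 * π * Complex.I * k * t)) t := fun t => by
    have := (((hasDerivAt_id (t : ℂ)).const_mul (2 * π * Complex.I * k)).cexp.div_const
      (2 * π * Complex.I * k)).comp_ofReal
    simpa [hck] using this
  induction m with
  | zero =>
    rw [intervalIntegral.integral_eq_sub_of_hasDerivAt
      (f := fun t : ℝ => Complex.exp (2 * π * Complex.I * k * t) / (2 * π * Complex.I * k))
      (fun t _ => by simpa using hd t) (Continuous.intervalIntegrable (by fun_prop) _ _)]
    simp [hexp]
  | succ m ih =>
    have hu : ∀ t : ℝ, HasDerivAt (fun t : ℝ => (1 - t : ℂ) ^ (m + 1) / (m + 1)!)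
        (-((1 - t : ℂ) ^ m / m !)) t := fun t => by
      have := ((((hasDerivAt_id (t : ℂ)).const_sub 1).pow (m + 1)).div_const
        ((m + 1)! : ℂ)).comp_ofReal
      convert! this using 1
      have : (m ! : ℂ) ≠ 0 := by exact_mod_cast m.factorial_ne_zero
      have : (m + 1 : ℂ) ≠ 0 := by exact_mod_cast m.succ_ne_zero
      simp only [Nat.factorial_succ, id]
      push_cast
      field_simp
    rw [intervalIntegral.integral_mul_deriv_eq_deriv_mul (fun t _ => hu t) (fun t _ => hd t)
      (Continuous.intervalIntegrable (by fun_prop) _ _)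
      (Continuous.intervalIntegrable (by fun_prop) _ _)]
    have h2 : ∫ t in (0 : ℝ)..1, -((1 - t : ℂ) ^ m / m !) *
        (Complex.exp (2 * π * Complex.I * k * t) / (2 * π * Complex.I * k)) =
        -(∫ t in (0 : ℝ)..1, (1 - t : ℂ) ^ m / m ! * Complex.exp (2 * π * Complex.I * k * t)) /
          (2 * π * Complex.I * k) := by
      rw [← intervalIntegral.integral_neg, ← intervalIntegral.integral_div]
      congr 1; ext t; ring
    rw [h2]
    generalize (∫ t in (0 : ℝ)..1, (1 - t : ℂ) ^ m / m ! *
      Complex.exp (2 * π * Complex.I * k * t)) = A at ih ⊢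
    rw [sum_range_succ]
    have h3 : ∑ j ∈ range m, (2 * π * Complex.I) ^ (j + 1) / (j + 1)! / (k : ℂ) ^ (m + 1 - j) =
        (∑ j ∈ range m, (2 * π * Complex.I) ^ (j + 1) / (j + 1)! / (k : ℂ) ^ (m - j)) / k := by
      rw [sum_div]
      refine sum_congr rfl fun j hj => ?_
      rw [Nat.sub_add_comm (mem_range.1 hj).le, pow_succ (k : ℂ), div_div _ _ (k : ℂ)]
    rw [h3, neg_eq_iff_eq_neg.1 ih.symm]
    generalize 2 * π * Complex.I = c at *
    have : ((m + 1)! : ℂ) ≠ 0 := by exact_mod_cast (m + 1).factorial_ne_zero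
    simp
    field_simp
    ring

lemma integral_weight_mul_exp (m : ℕ) {k : ℤ} (hk : k ≠ 0) :
    (2 * π * Complex.I) ^ (m + 2) *
        ∫ t in (0 : ℝ)..1, ((t * ((1 - t) ^ m / m !) : ℝ) : ℂ) *
          Complex.exp (2 * π * Complex.I * k * t) =
      2 * π * Complex.I * (m + 1) / (k : ℂ) ^ (m + 1) +
        ∑ i ∈ range m, (m - (i + 1)) / (i + 2)! * (2 * π * Complex.I) ^ (i + 2) /
          (k : ℂ) ^ (m - i) := by
  have h1 : ∫ t in (0 : ℝ)..1, ((t * ((1 - t) ^ m / m !) : ℝ) : ℂ) *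
          Complex.exp (2 * π * Complex.I * k * t) =
      (∫ t in (0 : ℝ)..1, (1 - t : ℂ) ^ m / m ! * Complex.exp (2 * π * Complex.I * k * t)) -
      (m + 1) * ∫ t in (0 : ℝ)..1, (1 - t : ℂ) ^ (m + 1) / (m + 1)! *
        Complex.exp (2 * π * Complex.I * k * t) := by
    rw [← intervalIntegral.integral_const_mul, ← intervalIntegral.integral_sub
      (Continuous.intervalIntegrable (by fun_prop) _ _)
      (Continuous.intervalIntegrable (by fun_prop) _ _)]
    congr 1; ext t
    have : (m ! : ℂ) ≠ 0 := by exact_mod_cast m.factorial_ne_zero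
    have : (m + 1 : ℂ) ≠ 0 := by exact_mod_cast m.succ_ne_zero
    simp only [Nat.factorial_succ]
    push_cast
    field_simp
    ring
  have h2 := integral_simplex_mul_exp m hk
  have h3 := integral_simplex_mul_exp (m + 1) hk
  have h4 : ∑ i ∈ range m, ((m - (i + 1)) / (i + 2)! * (2 * π * Complex.I) ^ (i + 2) /
          (k : ℂ) ^ (m - i)) =
      (m + 1) * (∑ i ∈ range m,
        (2 * π * Complex.I) ^ (i + 1 + 1) / (i + 1 + 1)! / (k : ℂ) ^ (m + 1 - (i + 1))) -
      (∑ i ∈ range m, (2 * π * Complex.I) ^ (i + 1) / (i + 1)! / (k : ℂ) ^ (m - i)) *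
        (2 * π * Complex.I) := by
    rw [mul_sum, sum_mul, ← sum_sub_distrib]
    refine sum_congr rfl fun i hi => ?_
    have : ((i + 1)! : ℂ) ≠ 0 := by exact_mod_cast (i + 1).factorial_ne_zero
    have : (i + 1 + 1 : ℂ) ≠ 0 := by exact_mod_cast (i + 1).succ_ne_zero
    have : (k : ℂ) ≠ 0 := by exact_mod_cast hk
    simp only [show i + 2 = i + 1 + 1 from rfl, Nat.factorial_succ (i + 1),
      Nat.add_sub_add_right]
    generalize 2 * π * Complex.I = c
    push_cast
    field_simp
    ring
  rw [h1, mul_sub, mul_left_comm, h3, pow_succ, mul_right_comm, h2, sum_range_succ', h4]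
  simp only [zero_add, pow_one, Nat.factorial_one, Nat.cast_one, div_one, Nat.sub_zero]
  ring

lemma tendsto_sum_odd_part {p : ℕ} (hp : p ≠ 1) :
    Filter.Tendsto (fun N : ℕ => ∑ k ∈ range N,
      (1 / (((k + 1 : ℕ) : ℤ) : ℂ) ^ p - 1 / ((-((k + 1 : ℕ) : ℤ) : ℤ) : ℂ) ^ p))
      Filter.atTop (nhds (2 * zetaOdd p)) := by
  unfold zetaOdd
  split_ifs with hodd
  · have hp1 : 1 < p := by
      have := hodd.pos
      omega
    have hs : Summable fun n : ℕ => 1 / (n : ℂ) ^ p :=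
      Summable.of_norm (by simpa using Real.summable_nat_pow_inv.2 hp1)
    have h := (((summable_nat_add_iff 1).2 hs).hasSum.mul_left 2).tendsto_sum_nat
    rw [← hs.sum_add_tsum_nat_add 1 |>.trans (zeta_nat_eq_tsum_of_gt_one hp1).symm]
    convert h using 2
    · refine sum_congr rfl fun k _ => ?_
      push_cast
      rw [hodd.neg_pow]
      ring
    · simp [hodd.pos.ne']
  · have : ∀ k : ℕ,
        1 / (((k + 1 : ℕ) : ℤ) : ℂ) ^ p - 1 / ((-((k + 1 : ℕ) : ℤ) : ℤ) : ℂ) ^ p = 0 := fun k => by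
      push_cast
      rw [(Nat.not_odd_iff_even.1 hodd).neg_pow, sub_self]
    simp only [this, sum_const_zero, mul_zero]
    exact tendsto_const_nhds

lemma tendsto_sum_integral_weight (m : ℕ) (hm : 1 ≤ m) :
    Filter.Tendsto (fun N : ℕ => ∑ k ∈ range N, -(1 / 2 : ℂ) * ((2 * π * Complex.I) ^ (m + 2) *
        (∫ t in (0 : ℝ)..1, ((t * ((1 - t) ^ m / m !) : ℝ) : ℂ) *
          Complex.exp (2 * π * Complex.I * ((k + 1 : ℕ) : ℤ) * t)) -
        (2 * π * Complex.I) ^ (m + 2) *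
        ∫ t in (0 : ℝ)..1, ((t * ((1 - t) ^ m / m !) : ℝ) : ℂ) *
          Complex.exp (2 * π * Complex.I * (-((k + 1 : ℕ) : ℤ) : ℤ) * t)))
      Filter.atTop (nhds (-(2 * π * Complex.I * (m + 1) * zetaOdd (m + 1)) -
        ∑ i ∈ range m, (m - (i + 1)) / (i + 2)! * (2 * π * Complex.I) ^ (i + 2) *
          zetaOdd (m - i))) := by
  have h0 := (tendsto_sum_odd_part (p := m + 1) (by omega)).const_mul
    (-(1 / 2) * (2 * π * Complex.I * (m + 1)))
  have hi : ∀ i ∈ range m, Filter.Tendsto (fun N : ℕ =>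
      (-(1 / 2) * ((m - (i + 1)) / (i + 2)! * (2 * π * Complex.I) ^ (i + 2))) * ∑ k ∈ range N,
      (1 / (((k + 1 : ℕ) : ℤ) : ℂ) ^ (m - i) - 1 / ((-((k + 1 : ℕ) : ℤ) : ℤ) : ℂ) ^ (m - i)))
      Filter.atTop (nhds ((-(1 / 2) * ((m - (i + 1)) / (i + 2)! * (2 * π * Complex.I) ^ (i + 2))) *
        (2 * zetaOdd (m - i)))) := fun i hi => by
    by_cases hmi : m - i = 1
    · have : (m : ℂ) - (i + 1) = 0 := by
        rw [show m = i + 1 by omega]; push_cast; ring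
      simp [this]
    · exact (tendsto_sum_odd_part hmi).const_mul _
  convert! h0.add (tendsto_finsetSum _ hi) using 1
  · ext N
    simp only [mul_sum]
    rw [sum_comm, ← sum_add_distrib]
    refine sum_congr rfl fun k _ => ?_
    rw [integral_weight_mul_exp m (by positivity), integral_weight_mul_exp m (by simp; omega)]
    rw [add_sub_add_comm, ← sum_sub_distrib, mul_add, mul_sum]
    congr 1
    · ring
    · exact sum_congr rfl fun i _ => by ring
  · congr 1
    rw [sub_eq_add_neg, ← sum_neg_distrib]
    congr 1
    · ring
    · exact sum_congr rfl fun i _ => by ring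

lemma norm_exp_sub_one_ge {t : ℝ} (ht : t ∈ Set.Ioo (0 : ℝ) 1) :
    t * (1 - t) ≤ ‖Complex.exp (2 * π * Complex.I * t) - 1‖ := by
  have h : ‖Complex.exp (2 * π * Complex.I * t) - 1‖ = 2 * Real.sin (π * t) := by
    have := Complex.norm_exp_I_mul_ofReal_sub_one (2 * π * t)
    rw [show 2 * π * t / 2 = π * t by ring, Real.norm_of_nonneg
      (mul_nonneg zero_le_two (Real.sin_nonneg_of_nonneg_of_le_pi
        (mul_nonneg Real.pi_pos.le ht.1.le) (mul_le_of_le_one_right Real.pi_pos.le ht.2.le)))]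
      at this
    rw [← this]
    push_cast
    ring_nf
  have hpi := Real.pi_pos
  have ht0 := ht.1
  have ht1 := ht.2
  rw [h]
  rcases le_total t (1 / 2) with h2 | h2
  · have := Real.mul_le_sin (x := π * t) (by positivity) (by nlinarith)
    rw [show 2 / π * (π * t) = 2 * t by field_simp] at this
    nlinarith
  · have := Real.mul_le_sin (x := π * (1 - t)) (mul_nonneg hpi.le (by linarith)) (by nlinarith)
    rw [show 2 / π * (π * (1 - t)) = 2 * (1 - t) by field_simp,
      show π * (1 - t) = π - π * t by ring, Real.sin_pi_sub] at this
    nlinarith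

lemma norm_weight_le {m : ℕ} (hm : 1 ≤ m) {t : ℝ} (ht : t ∈ Set.Ioo (0 : ℝ) 1) :
    ‖((t * ((1 - t) ^ m / m !) : ℝ) : ℂ)‖ ≤ t * (1 - t) := by
  have ht0 := ht.1
  have ht1 : 0 < 1 - t := sub_pos.2 ht.2
  rw [Complex.norm_real, Real.norm_of_nonneg (by positivity)]
  gcongr
  calc (1 - t) ^ m / m ! ≤ (1 - t) ^ m :=
        div_le_self (by positivity) (by exact_mod_cast m.factorial_pos)
    _ ≤ (1 - t) ^ 1 := pow_le_pow_of_le_one ht1.le (by linarith) hm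
    _ = 1 - t := pow_one _

lemma integrableOn_weight_div {m : ℕ} (hm : 1 ≤ m) :
    IntegrableOn (fun t : ℝ => ((t * ((1 - t) ^ m / m !) : ℝ) : ℂ) /
      (Complex.exp (2 * π * Complex.I * t) - 1)) (Set.Ioo 0 1) := by
  refine IntegrableOn.of_bound (by simp) (Measurable.aestronglyMeasurable (by fun_prop)) 1
    ((ae_restrict_iff' measurableSet_Ioo).2 (.of_forall fun t ht => ?_))
  rw [norm_div]
  exact div_le_one_of_le₀ ((norm_weight_le hm ht).trans (norm_exp_sub_one_ge ht)) (norm_nonneg _)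

lemma integrableOn_weight_div_mul_exp {m : ℕ} (hm : 1 ≤ m) (k : ℤ) :
    IntegrableOn (fun t : ℝ => ((t * ((1 - t) ^ m / m !) : ℝ) : ℂ) /
      (Complex.exp (2 * π * Complex.I * t) - 1) * Complex.exp (2 * π * Complex.I * k * t))
      (Set.Ioo 0 1) := by
  refine Integrable.mul_bdd (c := 1) (integrableOn_weight_div hm) (by fun_prop)
    (.of_forall fun t => le_of_eq ?_)
  rw [show 2 * π * Complex.I * k * t = ((2 * π * k * t : ℝ) : ℂ) * Complex.I by push_cast; ring]
  exact Complex.norm_exp_ofReal_mul_I _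

lemma pi_mul_cot_eq {t : ℝ} :
    (π : ℂ) * Complex.cot (π * t) = π * Complex.I *
      ((Complex.exp (2 * π * Complex.I * t) + 1) / (Complex.exp (2 * π * Complex.I * t) - 1)) := by
  rw [Complex.cot_eq_exp_ratio, show 2 * Complex.I * (π * t) = 2 * π * Complex.I * t by ring,
    ← neg_sub (Complex.exp (2 * π * Complex.I * t)) 1, mul_neg, div_neg, ← div_div,
    div_right_comm, Complex.div_I]
  ring

lemma integrableOn_weight_mul_cot {m : ℕ} (hm : 1 ≤ m) :
    IntegrableOn (fun t : ℝ => ((t * ((1 - t) ^ m / m !) : ℝ) : ℂ) *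
      (π * Complex.cot (π * t))) (Set.Ioo 0 1) := by
  refine (((integrableOn_weight_div_mul_exp hm 1).add
    (integrableOn_weight_div hm)).const_mul (π * Complex.I)).congr (.of_forall fun t => ?_)
  beta_reduce
  rw [pi_mul_cot_eq]
  simp only [Pi.add_apply, Int.cast_one, mul_one]
  ring

lemma tendsto_integral_weight_div_mul_exp (m : ℕ) {a : ℕ → ℤ}
    (ha : Filter.Tendsto (fun N => (a N : ℝ)) Filter.atTop (Filter.cocompact ℝ)) :
    Filter.Tendsto (fun N => ∫ t in Set.Ioo (0 : ℝ) 1, ((t * ((1 - t) ^ m / m !) : ℝ) : ℂ) /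
      (Complex.exp (2 * π * Complex.I * t) - 1) * Complex.exp (2 * π * Complex.I * a N * t))
      Filter.atTop (nhds 0) := by
  have hneg : Filter.Tendsto (fun N => -(a N : ℝ)) Filter.atTop (Filter.cocompact ℝ) :=
    ((Homeomorph.neg ℝ).isClosedEmbedding.tendsto_cocompact).comp ha
  refine ((Real.tendsto_integral_exp_smul_cocompact ((Set.Ioo (0 : ℝ) 1).indicator
    fun t : ℝ => ((t * ((1 - t) ^ m / m !) : ℝ) : ℂ) /
      (Complex.exp (2 * π * Complex.I * t) - 1))).comp hneg).congr fun N => ?_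
  rw [← integral_indicator measurableSet_Ioo]
  refine integral_congr_ae (.of_forall fun t => ?_)
  simp only [Set.indicator, Circle.smul_def, Real.fourierChar_apply]
  split_ifs
  · rw [smul_eq_mul, mul_comm]
    congr 2
    push_cast
    ring
  · simp

lemma sum_exp_sub_exp {t : ℝ} (ht : t ∈ Set.Ioo (0 : ℝ) 1) (N : ℕ) :
    ∑ k ∈ range N, (Complex.exp (2 * π * Complex.I * ((k + 1 : ℕ) : ℤ) * t) -
        Complex.exp (2 * π * Complex.I * (-((k + 1 : ℕ) : ℤ) : ℤ) * t)) =
      (Complex.exp (2 * π * Complex.I * ((N + 1 : ℕ) : ℤ) * t) +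
        Complex.exp (2 * π * Complex.I * (-(N : ℕ) : ℤ) * t) -
        (Complex.exp (2 * π * Complex.I * t) + 1)) / (Complex.exp (2 * π * Complex.I * t) - 1) := by
  have hz : Complex.exp (2 * π * Complex.I * t) - 1 ≠ 0 := norm_pos_iff.1
    ((mul_pos ht.1 (sub_pos.2 ht.2)).trans_le (norm_exp_sub_one_ge ht))
  have hz0 := Complex.exp_ne_zero (2 * π * Complex.I * t)
  have hp : ∀ k : ℕ, Complex.exp (2 * π * Complex.I * ((k : ℕ) : ℤ) * t) =
      Complex.exp (2 * π * Complex.I * t) ^ k := fun k => by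
    rw [← Complex.exp_nat_mul]; push_cast; ring_nf
  have hn : ∀ k : ℕ, Complex.exp (2 * π * Complex.I * (-((k : ℕ) : ℤ) : ℤ) * t) =
      (Complex.exp (2 * π * Complex.I * t) ^ k)⁻¹ := fun k => by
    rw [← hp, ← Complex.exp_neg]; push_cast; ring_nf
  simp only [hp, hn]
  generalize Complex.exp (2 * π * Complex.I * t) = z at *
  rw [eq_div_iff hz]
  induction N with
  | zero => simp
  | succ N ih =>
    rw [sum_range_succ, add_mul, ih]
    field_simp
    ring

lemma tendsto_sum_integral_weight_cot {m : ℕ} (hm : 1 ≤ m) :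
    Filter.Tendsto (fun N : ℕ => ∑ k ∈ range N, -(1 / 2 : ℂ) * ((2 * π * Complex.I) ^ (m + 2) *
        (∫ t in (0 : ℝ)..1, ((t * ((1 - t) ^ m / m !) : ℝ) : ℂ) *
          Complex.exp (2 * π * Complex.I * ((k + 1 : ℕ) : ℤ) * t)) -
        (2 * π * Complex.I) ^ (m + 2) *
        ∫ t in (0 : ℝ)..1, ((t * ((1 - t) ^ m / m !) : ℝ) : ℂ) *
          Complex.exp (2 * π * Complex.I * (-((k + 1 : ℕ) : ℤ) : ℤ) * t)))
      Filter.atTop (nhds ((2 * π * Complex.I) ^ (m + 1) *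
        ∫ t in Set.Ioo (0 : ℝ) 1, ((t * ((1 - t) ^ m / m !) : ℝ) : ℂ) *
          (π * Complex.cot (π * t)))) := by
  have hcast : Filter.Tendsto (fun N : ℕ => (N : ℝ)) Filter.atTop (Filter.cocompact ℝ) :=
    tendsto_natCast_atTop_atTop.mono_right atTop_le_cocompact
  have h1 := tendsto_integral_weight_div_mul_exp m (a := fun N => ((N + 1 : ℕ) : ℤ)) (by
    simpa [Function.comp_def] using hcast.comp (Filter.tendsto_add_atTop_nat 1))
  have h2 := tendsto_integral_weight_div_mul_exp m (a := fun N => (-(N : ℕ) : ℤ)) (by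
    simpa [Function.comp_def] using
      ((Homeomorph.neg ℝ).isClosedEmbedding.tendsto_cocompact).comp hcast)
  have h3 := ((h1.add h2).const_mul (π * Complex.I)).const_sub
    (∫ t in Set.Ioo (0 : ℝ) 1, ((t * ((1 - t) ^ m / m !) : ℝ) : ℂ) * (π * Complex.cot (π * t)))
  have h4 := h3.const_mul ((2 * π * Complex.I) ^ (m + 1))
  rw [add_zero, mul_zero, sub_zero] at h4
  refine h4.congr fun N => ?_
  have hint : ∀ k : ℤ, IntegrableOn (fun t : ℝ => ((t * ((1 - t) ^ m / m !) : ℝ) : ℂ) *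
      Complex.exp (2 * π * Complex.I * k * t)) (Set.Ioo 0 1) := fun k =>
    (Continuous.integrableOn_Icc (by fun_prop)).mono_set Set.Ioo_subset_Icc_self
  have hsum : IntegrableOn (fun t : ℝ => π * Complex.I *
      (((t * ((1 - t) ^ m / m !) : ℝ) : ℂ) / (Complex.exp (2 * π * Complex.I * t) - 1) *
        Complex.exp (2 * π * Complex.I * ((N + 1 : ℕ) : ℤ) * t) +
      ((t * ((1 - t) ^ m / m !) : ℝ) : ℂ) / (Complex.exp (2 * π * Complex.I * t) - 1) *
        Complex.exp (2 * π * Complex.I * (-(N : ℕ) : ℤ) * t))) (Set.Ioo 0 1) :=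
    ((integrableOn_weight_div_mul_exp hm _).add
      (integrableOn_weight_div_mul_exp hm _)).const_mul _
  simp only [intervalIntegral.integral_of_le zero_le_one, integral_Ioc_eq_integral_Ioo]
  rw [← integral_add (integrableOn_weight_div_mul_exp hm _)
      (integrableOn_weight_div_mul_exp hm _), ← integral_const_mul,
    ← integral_sub (integrableOn_weight_mul_cot hm) hsum]
  have h5 : ∀ k : ℕ, -(1 / 2 : ℂ) * ((2 * π * Complex.I) ^ (m + 2) *
        (∫ t in Set.Ioo (0 : ℝ) 1, ((t * ((1 - t) ^ m / m !) : ℝ) : ℂ) *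
          Complex.exp (2 * π * Complex.I * ((k + 1 : ℕ) : ℤ) * t)) -
        (2 * π * Complex.I) ^ (m + 2) *
        ∫ t in Set.Ioo (0 : ℝ) 1, ((t * ((1 - t) ^ m / m !) : ℝ) : ℂ) *
          Complex.exp (2 * π * Complex.I * (-((k + 1 : ℕ) : ℤ) : ℤ) * t)) =
      (2 * π * Complex.I) ^ (m + 1) * (-(π * Complex.I) *
        ∫ t in Set.Ioo (0 : ℝ) 1, (((t * ((1 - t) ^ m / m !) : ℝ) : ℂ) *
          Complex.exp (2 * π * Complex.I * ((k + 1 : ℕ) : ℤ) * t) -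
          ((t * ((1 - t) ^ m / m !) : ℝ) : ℂ) *
          Complex.exp (2 * π * Complex.I * (-((k + 1 : ℕ) : ℤ) : ℤ) * t))) := fun k => by
    rw [integral_sub (hint _) (hint _)]
    ring
  simp only [h5]
  have hdiff : ∀ k : ℕ, IntegrableOn (fun t : ℝ => ((t * ((1 - t) ^ m / m !) : ℝ) : ℂ) *
      Complex.exp (2 * π * Complex.I * ((k + 1 : ℕ) : ℤ) * t) -
      ((t * ((1 - t) ^ m / m !) : ℝ) : ℂ) *
      Complex.exp (2 * π * Complex.I * (-((k + 1 : ℕ) : ℤ) : ℤ) * t)) (Set.Ioo 0 1) := fun k =>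
    (hint _).sub (hint _)
  rw [← mul_sum, ← mul_sum, ← integral_finsetSum _ fun k _ => hdiff k,
    ← integral_const_mul (-(π * Complex.I))]
  refine congrArg _ (setIntegral_congr_fun measurableSet_Ioo fun t ht => ?_)
  simp only [← mul_sub]
  rw [← mul_sum, sum_exp_sub_exp ht, pi_mul_cot_eq]
  ring

lemma norm_qterm_le {τ : ℂ} (hτ : 0 < τ.im) (t : ℝ) (mp : ℕ × ℕ) :
    ‖(Complex.exp (2 * π * Complex.I * ((mp.1 : ℂ) + 1) * t) -
          Complex.exp (-(2 * π * Complex.I * ((mp.1 : ℂ) + 1) * t))) *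
        Complex.exp (2 * π * Complex.I * τ) ^ ((mp.1 + 1) * (mp.2 + 1))‖ ≤
      2 * Real.exp (-(2 * π * τ.im)) * (Real.exp (-(2 * π * τ.im)) ^ mp.1 *
        Real.exp (-(2 * π * τ.im)) ^ mp.2) := by
  have hq : ‖Complex.exp (2 * π * Complex.I * τ)‖ = Real.exp (-(2 * π * τ.im)) := by
    rw [Complex.norm_exp]; simp
  have hq1 : Real.exp (-(2 * π * τ.im)) ≤ 1 := by
    rw [Real.exp_le_one_iff]; have := Real.pi_pos; simp; positivity
  have h1 : ‖Complex.exp (2 * π * Complex.I * ((mp.1 : ℂ) + 1) * t)‖ = 1 := by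
    rw [Complex.norm_exp]; simp
  have h2 : ‖Complex.exp (-(2 * π * Complex.I * ((mp.1 : ℂ) + 1) * t))‖ = 1 := by
    rw [Complex.norm_exp]; simp
  rw [norm_mul, norm_pow, hq]
  calc _ ≤ 2 * Real.exp (-(2 * π * τ.im)) ^ (1 + (mp.1 + mp.2)) := by
        gcongr ?_ * ?_
        · exact (norm_sub_le _ _).trans (by rw [h1, h2]; norm_num)
        · exact pow_le_pow_of_le_one (Real.exp_pos _).le hq1 (by nlinarith)
    _ = _ := by ring

lemma hasSum_qbound {r : ℝ} (h0 : 0 ≤ r) (h1 : r < 1) :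
    HasSum (fun mp : ℕ × ℕ => 2 * r * (r ^ mp.1 * r ^ mp.2)) (2 * r * ((1 - r)⁻¹ * (1 - r)⁻¹)) := by
  have hs := hasSum_geometric_of_lt_one h0 h1
  exact (hs.mul hs (hs.summable.mul_of_nonneg hs.summable (fun _ => pow_nonneg h0 _)
    fun _ => pow_nonneg h0 _)).mul_left _

lemma continuous_qsum {τ : ℂ} (hτ : 0 < τ.im) :
    Continuous fun t : ℝ => ∑' mp : ℕ × ℕ,
      (Complex.exp (2 * π * Complex.I * ((mp.1 : ℂ) + 1) * t) -
          Complex.exp (-(2 * π * Complex.I * ((mp.1 : ℂ) + 1) * t))) *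
        Complex.exp (2 * π * Complex.I * τ) ^ ((mp.1 + 1) * (mp.2 + 1)) :=
  continuous_tsum (fun _ => by fun_prop)
    (hasSum_qbound (Real.exp_pos _).le (Real.exp_lt_one_iff.2 (by
      have := Real.pi_pos; simp; positivity))).summable
    fun mp t => norm_qterm_le hτ t mp

lemma norm_qsum_le {τ : ℂ} (hτ : 0 < τ.im) (hτ' : Real.exp (-(2 * π * τ.im)) ≤ 1 / 2) (t : ℝ) :
    ‖∑' mp : ℕ × ℕ,
      (Complex.exp (2 * π * Complex.I * ((mp.1 : ℂ) + 1) * t) -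
          Complex.exp (-(2 * π * Complex.I * ((mp.1 : ℂ) + 1) * t))) *
        Complex.exp (2 * π * Complex.I * τ) ^ ((mp.1 + 1) * (mp.2 + 1))‖ ≤
      8 * Real.exp (-(2 * π * τ.im)) := by
  refine (tsum_of_norm_bounded (hasSum_qbound (Real.exp_pos _).le (hτ'.trans_lt (by norm_num)))
    fun mp => norm_qterm_le hτ t mp).trans ?_
  have h0 := Real.exp_pos (-(2 * π * τ.im))
  generalize Real.exp (-(2 * π * τ.im)) = r at *
  have : (1 - r)⁻¹ ≤ 2 := by
    rw [inv_le_comm₀ (by linarith) two_pos]; linarith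
  have h1 : 0 ≤ (1 - r)⁻¹ := inv_nonneg.2 (by linarith)
  calc 2 * r * ((1 - r)⁻¹ * (1 - r)⁻¹) ≤ 2 * r * (2 * 2) := by gcongr
    _ = 8 * r := by ring

lemma measurable_fKr_one {τ : ℂ} (hτ : 0 < τ.im) :
    Measurable fun t : ℝ => fKr 1 (t : ℂ) τ := by
  have := (continuous_qsum hτ).measurable
  simp only [fKr, Complex.cot]
  fun_prop

lemma Aell_penultimate_eq (m : ℕ) {τ : ℂ} (hτ : 0 < τ.im) :
    Aell (fun i : Fin (m + 2) => if (i : ℕ) = m then 1 else 0) τ =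
      (2 * π * Complex.I) ^ (m + 1) * ∫ x in Set.Ioo (0 : ℝ) 1,
        ((x * ((1 - x) ^ m / m !) : ℝ) : ℂ) * fKr 1 x τ := by
  rw [← integral_openSimplex_penultimate m (measurable_fKr_one hτ), ← integral_const_mul, Aell]
  congr 1
  ext t
  rw [Fin.prod_univ_castSucc, Fin.prod_univ_castSucc]
  simp only [Fin.val_castSucc, Fin.val_last, if_true, (Fin.is_lt _).ne, if_false,
    show m + 1 ≠ m by omega, fKr, prod_const, card_univ, Fintype.card_fin]
  ring

lemma norm_Aell_sub_le {m : ℕ} (hm : 1 ≤ m) {τ : ℂ} (hτ : 0 < τ.im)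
    (hτ' : Real.exp (-(2 * π * τ.im)) ≤ 1 / 2) :
    ‖Aell (fun i : Fin (m + 2) => if (i : ℕ) = m then 1 else 0) τ -
      (2 * π * Complex.I) ^ (m + 1) *
        ∫ t in Set.Ioo (0 : ℝ) 1, ((t * ((1 - t) ^ m / m !) : ℝ) : ℂ) *
          (π * Complex.cot (π * t))‖ ≤
      (2 * π) ^ (m + 2) * (8 * Real.exp (-(2 * π * τ.im))) := by
  have hc : ‖(2 * π * Complex.I : ℂ)‖ = 2 * π := by simp [abs_of_pos Real.pi_pos]
  have hcont := continuous_qsum hτ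
  have hbound := norm_qsum_le hτ hτ'
  rw [Aell_penultimate_eq m hτ]
  simp only [fKr]
  set G := fun t : ℝ => ∑' mp : ℕ × ℕ,
      (Complex.exp (2 * π * Complex.I * ((mp.1 : ℂ) + 1) * t) -
          Complex.exp (-(2 * π * Complex.I * ((mp.1 : ℂ) + 1) * t))) *
        Complex.exp (2 * π * Complex.I * τ) ^ ((mp.1 + 1) * (mp.2 + 1)) with hG
  have hGint : IntegrableOn (fun t : ℝ => ((t * ((1 - t) ^ m / m !) : ℝ) : ℂ) *
      (2 * π * Complex.I * G t)) (Set.Ioo 0 1) :=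
    (Continuous.integrableOn_Icc (by fun_prop)).mono_set Set.Ioo_subset_Icc_self
  have hsplit : ∫ t in Set.Ioo (0 : ℝ) 1, ((t * ((1 - t) ^ m / m !) : ℝ) : ℂ) *
        (π * Complex.cot (π * t) - 2 * π * Complex.I * G t) =
      (∫ t in Set.Ioo (0 : ℝ) 1, ((t * ((1 - t) ^ m / m !) : ℝ) : ℂ) *
        (π * Complex.cot (π * t))) -
      ∫ t in Set.Ioo (0 : ℝ) 1, ((t * ((1 - t) ^ m / m !) : ℝ) : ℂ) *
        (2 * π * Complex.I * G t) := by
    rw [← integral_sub (integrableOn_weight_mul_cot hm) hGint]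
    simp only [mul_sub]
  rw [hsplit, ← mul_sub, sub_sub_cancel_left, norm_mul, norm_pow, hc, norm_neg, pow_succ _ (m + 1),
    mul_assoc ((2 * π) ^ (m + 1))]
  refine mul_le_mul_of_nonneg_left ?_ (by positivity)
  have hvol : 1 * (2 * π * (8 * Real.exp (-(2 * π * τ.im)))) *
      volume.real (Set.Ioo (0 : ℝ) 1) = 2 * π * (8 * Real.exp (-(2 * π * τ.im))) := by simp
  rw [← hvol]
  refine norm_setIntegral_le_of_norm_le_const (by simp) fun t ht => ?_
  rw [norm_mul, norm_mul, hc]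
  gcongr
  · exact (norm_weight_le hm ht).trans (by nlinarith [ht.1, ht.2])
  · exact hbound t

lemma sum_Icc_eq_sum_range {m : ℕ} (hm : 1 ≤ m) :
    ∑ j ∈ Finset.Icc 2 (m + 1 - 2), (((m + 1 - j : ℕ) : ℂ) / ((j ! : ℕ) : ℂ)) *
        (2 * ↑π * Complex.I) ^ j * zetaOdd (m + 1 + 1 - j) =
      ∑ i ∈ range m, (m - (i + 1)) / (i + 2)! * (2 * π * Complex.I) ^ (i + 2) *
        zetaOdd (m - i) := by
  obtain ⟨r, rfl⟩ : ∃ r, m = r + 1 := ⟨m - 1, by omega⟩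
  rw [sum_range_succ]
  rcases r with _ | r
  · simp
  · have h2 : zetaOdd (r + 1 + 1 - r) = 0 := by
      rw [show r + 1 + 1 - r = 2 by omega]
      exact if_neg (by decide)
    rw [sum_range_succ, h2, mul_zero, add_zero]
    have h3 : ((r + 1 + 1 : ℕ) : ℂ) - ((r + 1 : ℕ) + 1) = 0 := by push_cast; ring
    rw [h3, zero_div, zero_mul, zero_mul, add_zero, ← Finset.Ico_add_one_right_eq_Icc,
      sum_Ico_eq_sum_range, show r + 1 + 1 + 1 - 2 + 1 - 2 = r by omega]
    refine sum_congr rfl fun i hi => ?_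
    have hi := mem_range.1 hi
    rw [add_comm 2 i, show r + 1 + 1 + 1 - (i + 2) = r + 1 - i by omega,
      show r + 1 + 1 + 1 + 1 - (i + 2) = r + 1 + 1 - i by omega,
      Nat.cast_sub (by omega : i ≤ r + 1)]
    congr 3
    push_cast
    ring

/-- For `n ≥ 2`, the A-elliptic multiple zeta value of the tuple
`(0,…,0,1,0)` (with `n−1` leading zeros) tends, as `Im τ → ∞` (uniformly in `Re τ`), to
`−2πi·n·ζ^{odd}(n) − Σ_{j=2}^{n−2} ((n−j)/j!)(2πi)^j ζ^{odd}(n+1−j)`. -/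
theorem Aell_constant_term_0_1_0 (n : ℕ) (hn : 2 ≤ n) :
    ∀ ε : ℝ, 0 < ε → ∃ T : ℝ, ∀ τ : ℂ, 0 < τ.im → T ≤ τ.im →
      ‖Aell (fun i : Fin (n + 1) => if (i : ℕ) = n - 1 then 1 else 0) τ -
          (-(2 * ↑π * Complex.I * (n : ℂ) * zetaOdd n) -
            ∑ j ∈ Finset.Icc 2 (n - 2),
              (((n - j : ℕ) : ℂ) / ((j ! : ℕ) : ℂ)) * (2 * ↑π * Complex.I) ^ j *
                zetaOdd (n + 1 - j))‖ < ε := by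
  intro ε hε
  obtain ⟨m, rfl⟩ : ∃ m, n = m + 1 := ⟨n - 1, by omega⟩
  have hm : 1 ≤ m := by omega
  have hlim : -(2 * ↑π * Complex.I * ((m + 1 : ℕ) : ℂ) * zetaOdd (m + 1)) -
      ∑ j ∈ Finset.Icc 2 (m + 1 - 2), (((m + 1 - j : ℕ) : ℂ) / ((j ! : ℕ) : ℂ)) *
        (2 * ↑π * Complex.I) ^ j * zetaOdd (m + 1 + 1 - j) =
      (2 * π * Complex.I) ^ (m + 1) *
        ∫ t in Set.Ioo (0 : ℝ) 1, ((t * ((1 - t) ^ m / m !) : ℝ) : ℂ) *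
          (π * Complex.cot (π * t)) := by
    rw [tendsto_nhds_unique (tendsto_sum_integral_weight_cot hm)
      (tendsto_sum_integral_weight m hm)]
    congr 1
    · push_cast; ring
    · exact sum_Icc_eq_sum_range hm
  have htend : Filter.Tendsto (fun y : ℝ => Real.exp (-(2 * π * y))) Filter.atTop (nhds 0) :=
    Real.tendsto_exp_neg_atTop_nhds_zero.comp
      (Filter.tendsto_id.const_mul_atTop (by positivity))
  have htend' := (htend.const_mul 8).const_mul ((2 * π) ^ (m + 2))
  rw [mul_zero, mul_zero] at htend'
  obtain ⟨T, hT⟩ := Filter.eventually_atTop.1 ((htend.eventually_le_const (by norm_num :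
    (0 : ℝ) < 1 / 2)).and (htend'.eventually_lt_const hε))
  refine ⟨T, fun τ hτ hTτ => ?_⟩
  rw [hlim]
  exact (norm_Aell_sub_le hm hτ (hT _ hTτ).1).trans_lt (hT _ hTτ).2
end

section
/- For all integers n ≥ 2 and r ≥ 1 and all τ ∈ ℍ: ∫₀¹ ((2πi·t)^{r−1}/(r−1)!) · f_n(t,τ) dt = (2πi)^r · B_n/(r!·n!) + ((−1)^{n−1}/(n−1)!) · Σ_{j=1}^{r−1} ((2πi)^{r−j}·(n+j−1)!/(r−j)!) · Γ_{n+j,j}(τ). (The left-hand side is the depth-one A-elliptic multiple zeta value A(n,0,…,0;τ) with r−1 zeros.) -/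
open scoped Real Nat
open Finset MeasureTheory

/-- The `q`-series `Γ_{N,k}(τ) = −((1+(−1)^N)/(N−1)!) Σ_{m,p≥1} m^{N−k−1} p^{−k} q^{mp}`
(the exponentially small part of a `k`-fold iterated primitive of the weight-`N` Eisenstein
series). -/
noncomputable def GammaEis (N k : ℕ) (τ : ℂ) : ℂ :=
  -((1 + (-1 : ℂ) ^ N) / ((N - 1)! : ℂ)) *
    ∑' mp : ℕ × ℕ,
      (((mp.1 + 1 : ℕ) : ℂ)) ^ ((N : ℤ) - (k : ℤ) - 1) *
        (((mp.2 + 1 : ℕ) : ℂ)) ^ (-(k : ℤ)) *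
        Complex.exp (2 * ↑π * Complex.I * τ) ^ ((mp.1 + 1) * (mp.2 + 1))

/-- Integration by parts for `tˢ⁺¹ exp (c a t)` on `[0, 1]` when the exponential is periodic. -/
theorem integral_pow_mul_exp_succ (c a : ℂ) (hc : c ≠ 0) (ha : a ≠ 0)
    (hper : Complex.exp (c * a) = 1) (s : ℕ) :
    (∫ t in (0 : ℝ)..1, (c * (t : ℂ)) ^ (s + 1) / ((s + 1)! : ℂ) * Complex.exp (c * a * t)) =
      c ^ s / ((s + 1)! : ℂ) * a⁻¹ -
        a⁻¹ * ∫ t in (0 : ℝ)..1, (c * (t : ℂ)) ^ s / (s ! : ℂ) * Complex.exp (c * a * t) := by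
  have hf : ((s ! : ℕ) : ℂ) ≠ 0 := Nat.cast_ne_zero.mpr s.factorial_ne_zero
  have hs : (s : ℂ) + 1 ≠ 0 := Nat.cast_add_one_ne_zero s
  have hderiv : ∀ t : ℝ, HasDerivAt
      (fun t : ℝ => (c * (t : ℂ)) ^ (s + 1) / ((s + 1)! : ℂ) * Complex.exp (c * a * t) / (c * a))
      (a⁻¹ * ((c * (t : ℂ)) ^ s / (s ! : ℂ) * Complex.exp (c * a * t)) +
        (c * (t : ℂ)) ^ (s + 1) / ((s + 1)! : ℂ) * Complex.exp (c * a * t)) t := by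
    intro t
    have h1 : HasDerivAt (fun t : ℝ => c * (t : ℂ)) c t := by
      simpa using (Complex.ofRealCLM.hasDerivAt (x := t)).const_mul c
    have h2 : HasDerivAt (fun t : ℝ => c * a * (t : ℂ)) (c * a) t := by
      simpa using (Complex.ofRealCLM.hasDerivAt (x := t)).const_mul (c * a)
    refine ((((h1.fun_pow (s + 1)).div_const _).fun_mul h2.cexp).div_const _).congr_deriv ?_
    rw [Nat.factorial_succ]
    push_cast
    field_simp
  have key := intervalIntegral.integral_eq_sub_of_hasDerivAt (a := 0) (b := 1)
    (fun t _ => hderiv t) (Continuous.intervalIntegrable (by fun_prop) _ _)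
  rw [intervalIntegral.integral_add (Continuous.intervalIntegrable (by fun_prop) _ _)
    (Continuous.intervalIntegrable (by fun_prop) _ _),
    intervalIntegral.integral_const_mul] at key
  rw [eq_sub_iff_add_eq, add_comm, key]
  simp only [Complex.ofReal_one, Complex.ofReal_zero, mul_one, mul_zero, hper]
  simp only [ne_eq, Nat.add_eq_zero_iff, one_ne_zero, and_false, not_false_eq_true, zero_pow,
    zero_div, zero_mul, sub_zero]
  field_simp
  ring

theorem integral_pow_mul_exp (c a : ℂ) (hc : c ≠ 0) (ha : a ≠ 0)
    (hper : Complex.exp (c * a) = 1) (s : ℕ) :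
    (∫ t in (0 : ℝ)..1, (c * (t : ℂ)) ^ s / (s ! : ℂ) * Complex.exp (c * a * t)) =
      ∑ j ∈ Finset.range s,
        (-1 : ℂ) ^ j * (c ^ (s - 1 - j) / ((s - j)! : ℂ)) * (a ^ (j + 1))⁻¹ := by
  induction s with
  | zero =>
    have h := integral_exp_mul_complex (a := 0) (b := 1) (mul_ne_zero hc ha)
    simpa [hper] using h
  | succ s ih =>
    rw [integral_pow_mul_exp_succ c a hc ha hper, ih, Finset.sum_range_succ', Finset.mul_sum,
      sub_eq_add_neg, add_comm, ← Finset.sum_neg_distrib]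
    congr 1
    · refine Finset.sum_congr rfl fun j _ => ?_
      rw [show s + 1 - 1 - (j + 1) = s - 1 - j by omega, show s + 1 - (j + 1) = s - j by omega]
      field_simp
      ring
    · simp

/-- `∑_{m,p} (p+1)ᵏ x^{(m+1)(p+1)}` converges for `0 ≤ x < 1`. -/
theorem summable_pow_mul_pow_mul_succ (k : ℕ) {x : ℝ} (hx0 : 0 ≤ x) (hx1 : x < 1) :
    Summable fun mp : ℕ × ℕ => ((mp.2 : ℝ) + 1) ^ k * x ^ ((mp.1 + 1) * (mp.2 + 1)) := by
  have h1 : Summable fun m : ℕ => x ^ m := summable_geometric_of_lt_one hx0 hx1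
  have h2 : Summable fun p : ℕ => ((p : ℝ) + 1) ^ k * x ^ (p + 1) := by
    have := summable_pow_mul_geometric_of_norm_lt_one k
      (show ‖x‖ < 1 by rwa [Real.norm_of_nonneg hx0])
    simpa using (summable_nat_add_iff 1).mpr this
  refine Summable.of_nonneg_of_le (fun _ => by positivity) (fun mp => ?_)
    (h1.mul_of_nonneg h2 (fun _ => by positivity) (fun _ => by positivity))
  calc ((mp.2 : ℝ) + 1) ^ k * x ^ ((mp.1 + 1) * (mp.2 + 1))
      ≤ ((mp.2 : ℝ) + 1) ^ k * x ^ (mp.1 + (mp.2 + 1)) := by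
        refine mul_le_mul_of_nonneg_left ?_ (by positivity)
        exact pow_le_pow_of_le_one hx0 hx1.le (by nlinarith [Nat.zero_le (mp.1 * mp.2)])
    _ = x ^ mp.1 * (((mp.2 : ℝ) + 1) ^ k * x ^ (mp.2 + 1)) := by rw [pow_add]; ring

/-- `∑_{m,p ≥ 1} m^{-j} pᵏ q^{mp}`. -/
noncomputable def lambertSeries (k j : ℕ) (q : ℂ) : ℂ :=
  ∑' mp : ℕ × ℕ,
    (((mp.1 : ℂ) + 1) ^ j)⁻¹ * (((mp.2 : ℂ) + 1) ^ k * q ^ ((mp.1 + 1) * (mp.2 + 1)))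

theorem summable_lambertSeries (k j : ℕ) {q : ℂ} (hq : ‖q‖ < 1) :
    Summable fun mp : ℕ × ℕ =>
      (((mp.1 : ℂ) + 1) ^ j)⁻¹ * (((mp.2 : ℂ) + 1) ^ k * q ^ ((mp.1 + 1) * (mp.2 + 1))) := by
  refine Summable.of_norm_bounded (summable_pow_mul_pow_mul_succ k (norm_nonneg q) hq)
    fun mp => ?_
  have h (a : ℕ) : ‖(a : ℂ) + 1‖ = (a : ℝ) + 1 := by
    exact_mod_cast Complex.norm_natCast (a + 1)
  rw [norm_mul, norm_inv, norm_mul, norm_pow, norm_pow, norm_pow, h, h]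
  exact mul_le_of_le_one_left (by positivity) (inv_le_one_of_one_le₀ (one_le_pow₀ (by simp)))

theorem GammaEis_eq_lambertSeries (k j : ℕ) (τ : ℂ) :
    GammaEis (k + 1 + j) j τ =
      -((1 + (-1 : ℂ) ^ (k + 1 + j)) / ((k + j)! : ℂ)) *
        lambertSeries k j (Complex.exp (2 * ↑π * Complex.I * τ)) := by
  rw [GammaEis, show k + 1 + j - 1 = k + j by omega, lambertSeries,
    ← (Equiv.prodComm ℕ ℕ).tsum_eq]
  congr 1
  refine tsum_congr fun mp => ?_
  rw [show ((k + 1 + j : ℕ) : ℤ) - (j : ℤ) - 1 = (k : ℕ) by push_cast; ring]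
  simp only [Equiv.prodComm_apply, Prod.fst_swap, Prod.snd_swap, zpow_neg, zpow_natCast]
  push_cast
  rw [mul_comm (mp.2 + 1)]
  ring

/-- The integral over `[0, 1]` of a monomial against a single term of the `q`-expansion of
`f_n`. -/
theorem integral_pow_mul_exp_add_exp_neg (N s m : ℕ) :
    (∫ t in (0 : ℝ)..1, (2 * ↑π * Complex.I * (t : ℂ)) ^ s / (s ! : ℂ) *
        (Complex.exp (2 * ↑π * Complex.I * ((m : ℂ) + 1) * t) +
          (-1 : ℂ) ^ N * Complex.exp (-(2 * ↑π * Complex.I * ((m : ℂ) + 1) * t)))) =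
      ∑ j ∈ Finset.range s,
        (-1 : ℂ) ^ j * (1 + (-1 : ℂ) ^ (N + (j + 1))) *
          ((2 * ↑π * Complex.I) ^ (s - 1 - j) / ((s - j)! : ℂ)) *
            (((m : ℂ) + 1) ^ (j + 1))⁻¹ := by
  have hm : (m : ℂ) + 1 ≠ 0 := Nat.cast_add_one_ne_zero m
  have hper : Complex.exp (2 * ↑π * Complex.I * ((m : ℂ) + 1)) = 1 := by
    rw [Complex.exp_eq_one_iff]
    exact ⟨m + 1, by push_cast; ring⟩
  have hper' : Complex.exp (2 * ↑π * Complex.I * -((m : ℂ) + 1)) = 1 := by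
    rw [mul_neg, Complex.exp_neg, hper, inv_one]
  have h1 := integral_pow_mul_exp _ _ Complex.two_pi_I_ne_zero hm hper s
  have h2 := integral_pow_mul_exp _ _ Complex.two_pi_I_ne_zero (neg_ne_zero.mpr hm) hper' s
  simp only [mul_neg, neg_mul] at h2
  simp only [mul_add ((_ : ℂ) ^ s / _), mul_left_comm _ ((-1 : ℂ) ^ N)]
  rw [intervalIntegral.integral_add (Continuous.intervalIntegrable (by fun_prop) _ _)
    (Continuous.intervalIntegrable (by fun_prop) _ _),
    intervalIntegral.integral_const_mul, h1, h2, Finset.mul_sum, ← Finset.sum_add_distrib]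
  refine Finset.sum_congr rfl fun j _ => ?_
  rw [neg_pow ((m : ℂ) + 1), mul_inv, pow_add (-1 : ℂ) N, ← inv_pow (-1 : ℂ), inv_neg_one]
  ring

/-- Termwise integration of the `q`-expansion of `f_n` against a monomial. -/
theorem integral_pow_mul_tsum_exp (k N s : ℕ) {q : ℂ} (hq : ‖q‖ < 1) (b : ℂ) :
    (∫ t in (0 : ℝ)..1, (2 * ↑π * Complex.I * (t : ℂ)) ^ s / (s ! : ℂ) *
        (b - ∑' mp : ℕ × ℕ,
          (Complex.exp (2 * ↑π * Complex.I * ((mp.1 : ℂ) + 1) * t) +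
            (-1 : ℂ) ^ N * Complex.exp (-(2 * ↑π * Complex.I * ((mp.1 : ℂ) + 1) * t))) *
              ((mp.2 : ℂ) + 1) ^ k * q ^ ((mp.1 + 1) * (mp.2 + 1)))) =
      (2 * ↑π * Complex.I) ^ s / ((s + 1)! : ℂ) * b -
        ∑ j ∈ Finset.range s,
          (-1 : ℂ) ^ j * (1 + (-1 : ℂ) ^ (N + (j + 1))) *
            ((2 * ↑π * Complex.I) ^ (s - 1 - j) / ((s - j)! : ℂ)) *
              lambertSeries k (j + 1) q := by
  set P : ℝ → ℂ := fun t => (2 * ↑π * Complex.I * (t : ℂ)) ^ s / (s ! : ℂ) with hP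
  set E : ℕ → ℝ → ℂ := fun m t => Complex.exp (2 * ↑π * Complex.I * ((m : ℂ) + 1) * t) +
    (-1 : ℂ) ^ N * Complex.exp (-(2 * ↑π * Complex.I * ((m : ℂ) + 1) * t)) with hE
  set w : ℕ × ℕ → ℂ := fun mp => ((mp.2 : ℂ) + 1) ^ k * q ^ ((mp.1 + 1) * (mp.2 + 1)) with hw
  have hPc : Continuous P := by fun_prop
  have hEc (m : ℕ) : Continuous (E m) := by fun_prop
  have hws : Summable w := by simpa [hw] using summable_lambertSeries k 0 hq
  have hEb (m : ℕ) (t : ℝ) : ‖E m t‖ ≤ 2 := by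
    have h (x : ℂ) (hx : x.re = 0) : ‖Complex.exp x‖ = 1 := by
      rw [Complex.norm_exp, hx, Real.exp_zero]
    refine (norm_add_le _ _).trans ?_
    rw [norm_mul, norm_pow, norm_neg, norm_one, one_pow, h _ (by simp), h _ (by simp)]
    norm_num
  have hbound (mp : ℕ × ℕ) (t : ℝ) : ‖E mp.1 t * w mp‖ ≤ 2 * ‖w mp‖ := by
    rw [norm_mul]
    exact mul_le_mul_of_nonneg_right (hEb _ _) (norm_nonneg _)
  have hwb : Summable fun mp => 2 * ‖w mp‖ := hws.norm.mul_left 2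
  have hTc : Continuous fun t => ∑' mp, E mp.1 t * w mp :=
    continuous_tsum (fun mp => (hEc mp.1).mul continuous_const) hwb hbound
  have hswap : HasSum (fun mp : ℕ × ℕ => ∫ t in (0 : ℝ)..1, P t * (E mp.1 t * w mp))
      (∫ t in (0 : ℝ)..1, P t * ∑' mp, E mp.1 t * w mp) := by
    refine intervalIntegral.hasSum_integral_of_dominated_convergence
      (fun mp t => ‖P t‖ * (2 * ‖w mp‖)) (fun mp => ?_) (fun mp => ?_) ?_ ?_ ?_
    · exact (hPc.mul ((hEc mp.1).mul continuous_const)).aestronglyMeasurable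
    · refine .of_forall fun t _ => ?_
      rw [norm_mul]
      exact mul_le_mul_of_nonneg_left (hbound mp t) (norm_nonneg _)
    · exact .of_forall fun t _ => hwb.mul_left _
    · simp only [tsum_mul_left]
      exact (hPc.norm.mul continuous_const).intervalIntegrable _ _
    · exact .of_forall fun t _ => (Summable.of_norm_bounded hwb (hbound · t)).hasSum.mul_left _
  have hterm (mp : ℕ × ℕ) : (∫ t in (0 : ℝ)..1, P t * (E mp.1 t * w mp)) =
      ∑ j ∈ Finset.range s,
          (-1 : ℂ) ^ j * (1 + (-1 : ℂ) ^ (N + (j + 1))) *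
            ((2 * ↑π * Complex.I) ^ (s - 1 - j) / ((s - j)! : ℂ)) *
              ((((mp.1 : ℂ) + 1) ^ (j + 1))⁻¹ * w mp) := by
    simp only [← mul_assoc (P _)]
    rw [intervalIntegral.integral_mul_const, integral_pow_mul_exp_add_exp_neg, Finset.sum_mul]
    exact Finset.sum_congr rfl fun j _ => mul_assoc _ _ _
  have hmono : (∫ t in (0 : ℝ)..1, P t) = (2 * ↑π * Complex.I) ^ s / ((s + 1)! : ℂ) := by
    have hs : (s : ℂ) + 1 ≠ 0 := Nat.cast_add_one_ne_zero s
    have h : (∫ t in (0 : ℝ)..1, (t : ℂ) ^ s) = 1 / ((s : ℂ) + 1) := by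
      have := congrArg Complex.ofReal (integral_pow (a := 0) (b := 1) s)
      rw [← intervalIntegral.integral_ofReal] at this
      simpa using this
    simp only [hP, mul_pow _ (Complex.ofReal _)]
    rw [intervalIntegral.integral_div, intervalIntegral.integral_const_mul, h,
      Nat.factorial_succ]
    push_cast
    field_simp
  have hint₁ : IntervalIntegrable (fun t => P t * b) volume 0 1 :=
    (hPc.mul continuous_const).intervalIntegrable _ _
  have hint₂ : IntervalIntegrable (fun t => P t * ∑' mp, E mp.1 t * w mp) volume 0 1 :=
    (hPc.mul hTc).intervalIntegrable _ _
  trans ∫ t in (0 : ℝ)..1, (P t * b - P t * ∑' mp, E mp.1 t * w mp)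
  · simp only [hP, hE, hw, mul_sub, mul_assoc]
  rw [intervalIntegral.integral_sub hint₁ hint₂, intervalIntegral.integral_mul_const, hmono,
    ← hswap.tsum_eq]
  simp only [hterm]
  rw [Summable.tsum_finsetSum fun j _ => (summable_lambertSeries k (j + 1) hq).mul_left _]
  simp only [tsum_mul_left, lambertSeries]

/-- The depth-one A-elliptic multiple zeta value `A(n,0,…,0;τ)` (with `r−1`
zeros) in terms of iterated integrals of Eisenstein series:
`∫₀¹ ((2πit)^{r−1}/(r−1)!) f_n(t,τ) dt
  = (2πi)^r Bₙ/(r!·n!) + ((−1)^{n−1}/(n−1)!) Σ_{j=1}^{r−1} ((2πi)^{r−j}(n+j−1)!/(r−j)!) Γ_{n+j,j}(τ)`. -/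
theorem Aell_depth_one_eq_Eisenstein_integrals (n r : ℕ) (hn : 2 ≤ n) (hr : 1 ≤ r)
    (τ : ℂ) (hτ : 0 < τ.im) :
    (∫ t in Set.Ioo (0 : ℝ) 1,
        ((2 * ↑π * Complex.I * ((t : ℝ) : ℂ)) ^ (r - 1) / ((r - 1)! : ℂ)) *
          fKr n ((t : ℝ) : ℂ) τ) =
      (2 * ↑π * Complex.I) ^ r * (bernoulli n : ℂ) / ((r ! : ℂ) * (n ! : ℂ)) +
        ((-1 : ℂ) ^ (n - 1) / ((n - 1)! : ℂ)) *
          ∑ j ∈ Finset.Icc 1 (r - 1),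
            ((2 * ↑π * Complex.I) ^ (r - j) * ((n + j - 1)! : ℂ) / ((r - j)! : ℂ)) *
              GammaEis (n + j) j τ := by
  obtain ⟨k, rfl⟩ : ∃ k, n = k + 2 := ⟨n - 2, by omega⟩
  obtain ⟨s, rfl⟩ : ∃ s, r = s + 1 := ⟨r - 1, by omega⟩
  have hq : ‖Complex.exp (2 * ↑π * Complex.I * τ)‖ < 1 := by
    rw [Complex.norm_exp, Real.exp_lt_one_iff]
    simpa using mul_pos Real.two_pi_pos hτ
  rw [← integral_Ioc_eq_integral_Ioo, ← intervalIntegral.integral_of_le zero_le_one]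
  simp only [fKr, Nat.add_sub_cancel, mul_left_comm _ (2 * (π : ℂ) * Complex.I / _)]
  rw [intervalIntegral.integral_const_mul, integral_pow_mul_tsum_exp _ _ _ hq, mul_sub,
    sub_eq_add_neg]
  congr 1
  · rw [Nat.factorial_succ (k + 1)]
    have hk : (k : ℂ) + 1 + 1 ≠ 0 := by exact_mod_cast (k + 1).succ_ne_zero
    have hk' : (k : ℂ) + 2 ≠ 0 := by exact_mod_cast (k + 1).succ_ne_zero
    push_cast
    field_simp
    ring
  · rw [← Finset.Ico_succ_right_eq_Icc, Finset.sum_Ico_eq_sum_range, Finset.mul_sum,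
      Finset.mul_sum, ← Finset.sum_neg_distrib]
    refine Finset.sum_congr (by simp) fun j hj => ?_
    have hjs : j < s := by simpa using hj
    rw [add_comm 1 j, show k + 2 = k + 1 + 1 from rfl, GammaEis_eq_lambertSeries,
      show k + 1 + 1 + (j + 1) - 1 = k + 1 + (j + 1) by omega, show k + 1 + 1 - 1 = k + 1 by omega,
      show s + 1 - (j + 1) = s - 1 - j + 1 by omega, show s - j = s - 1 - j + 1 by omega]
    have hf : ((k + 1 + (j + 1))! : ℂ) ≠ 0 := Nat.cast_ne_zero.mpr (Nat.factorial_ne_zero _)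
    have hsign : (-1 : ℂ) ^ j * (1 + (-1 : ℂ) ^ (k + 1 + 1 + (j + 1))) =
        (-1 : ℂ) ^ (k + 1) * (1 + (-1 : ℂ) ^ (k + 1 + 1 + (j + 1))) := by
      rcases neg_one_pow_eq_or ℂ j with h | h <;> rcases neg_one_pow_eq_or ℂ k with h' | h' <;>
        simp [pow_add, h, h']
    rw [hsign]
    field_simp
    ring
end

section
/- For all integers n ≥ 2 and r ≥ 1 and all τ ∈ ℍ, the depth-one B-elliptic multiple zeta value B(n,0,…,0;τ) = τⁿ · ∫₀¹ ((2πi·t)^{r−1}/(r−1)!) · ω_n(τt,τ) dt (with r−1 zeros) equals ((2πi)^r τⁿ/(r−1)!) · Σ_{k=0}^{n} B_k/(k!·(n−k)!·(n−k+r)) − Σ_{p=0}^{r−2} (1/(r−1−p)!) · binom(n+p−1, p) · (2πi)^{r−n−p} · ζ(n+p) · τ^{−p} − (1 + (−1)^{n+r−1}) · binom(n+r−2, r−1) · (2πi)^{1−n} · ζ(n+r−1) · τ^{1−r} + ((2πi)^{r−1}/(n−1)!) · Σ_{j=1}^{r−1} ((n+j−1)!/(r−j)!) · Σ_{i=0}^{j−1}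 ((−1)^{j−i−1}·(n+i−1)!/(i!·(j−i−1)!)) · Σ_{k=1}^{n+i} ((−1)^{k−1}·(2πi)^{1−k}·τ^{n−k}/(n+i−k)!) · Γ_{n+j,k}(τ). -/
open scoped Real Nat
open Finset MeasureTheory

/-- The `d`-th finite difference of the falling factorial `x ↦ x.descFactorial K` at `N`. -/
theorem sum_alternating_choose_mul_descFactorial (d N K : ℕ) :
    ∑ i ∈ range (d + 1), (-1 : ℂ) ^ (d - i) * (d.choose i : ℂ) * ((N + i).descFactorial K : ℂ) =
      (K.descFactorial d : ℂ) * (N.descFactorial (K - d) : ℂ) := by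
  have key : ∀ (d K : ℕ) (N : ℕ), (fwdDiff 1)^[d] (fun x : ℕ => (x.descFactorial K : ℂ)) N =
      (K.descFactorial d : ℂ) * (N.descFactorial (K - d) : ℂ) := by
    intro d
    induction d with
    | zero => intro K N; simp
    | succ d ih =>
      intro K N
      have h1 : fwdDiff 1 (fun x : ℕ => (x.descFactorial K : ℂ)) =
          (K : ℂ) • fun x : ℕ => (x.descFactorial (K - 1) : ℂ) := by
        ext x
        cases K with
        | zero => simp [fwdDiff]
        | succ K =>
          simp only [fwdDiff, Nat.succ_descFactorial_succ, Pi.smul_apply, smul_eq_mul,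
            Nat.add_sub_cancel]
          rw [Nat.descFactorial_succ]
          rcases le_or_gt K x with h | h
          · push_cast [Nat.cast_sub h]; ring
          · simp [Nat.descFactorial_of_lt h]
      rw [Function.iterate_succ_apply, h1, fwdDiff_iter_const_smul, Pi.smul_apply, ih, smul_eq_mul]
      cases K with
      | zero => simp
      | succ K =>
        rw [Nat.succ_descFactorial_succ]
        simp only [Nat.add_sub_cancel, Nat.add_sub_add_right]
        push_cast; ring
  rw [← key, fwdDiff_iter_eq_sum_shift]
  refine sum_congr rfl fun i _ => ?_
  simp

/-- Repeated integration by parts of a polynomial against an exponential on `[0, 1]`. -/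
theorem integral_polynomial_mul_exp (P : Polynomial ℂ) (M : ℕ) (hM : P.natDegree < M)
    (c : ℂ) (hc : c ≠ 0) :
    ∫ t in (0 : ℝ)..1, P.eval (t : ℂ) * Complex.exp (-c * t) =
      ∑ l ∈ range M, ((Polynomial.derivative^[l] P).eval 0 -
        (Polynomial.derivative^[l] P).eval 1 * Complex.exp (-c)) / c ^ (l + 1) := by
  have hd : ∀ t : ℝ, HasDerivAt (fun t : ℝ => -∑ l ∈ range M,
      (Polynomial.derivative^[l] P).eval (t : ℂ) * Complex.exp (-c * t) / c ^ (l + 1))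
      (P.eval (t : ℂ) * Complex.exp (-c * t)) t := by
    intro t
    have h1 : ∀ l, HasDerivAt (fun z : ℂ => (Polynomial.derivative^[l] P).eval z *
        Complex.exp (-c * z) / c ^ (l + 1))
        (((Polynomial.derivative^[l+1] P).eval (t : ℂ) / c ^ (l + 1) -
          (Polynomial.derivative^[l] P).eval (t : ℂ) / c ^ l) * Complex.exp (-c * t)) (t : ℂ) := by
      intro l
      have h2 : HasDerivAt (fun z : ℂ => Complex.exp (-c * z)) (Complex.exp (-c * t) * (-c * 1))
        (t : ℂ) := ((hasDerivAt_id (t : ℂ)).const_mul (-c)).cexp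
      refine (((Polynomial.derivative^[l] P).hasDerivAt (t : ℂ)).fun_mul h2).div_const
        (c ^ (l + 1)) |>.congr_deriv ?_
      rw [Function.iterate_succ_apply']
      field_simp
      ring
    have h3 := (HasDerivAt.fun_sum (fun l (_ : l ∈ range M) => h1 l)).fun_neg.comp_ofReal
    refine h3.congr_deriv ?_
    rw [← Finset.sum_mul, Finset.sum_range_sub
      (fun l => (Polynomial.derivative^[l] P).eval (t : ℂ) / c ^ l),
      Polynomial.iterate_derivative_eq_zero hM]
    simp
  rw [intervalIntegral.integral_eq_sub_of_hasDerivAt (fun t _ => hd t)]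
  · rw [neg_sub_neg, ← Finset.sum_sub_distrib]
    refine sum_congr rfl fun l _ => ?_
    simp
    ring
  · apply Continuous.intervalIntegrable
    fun_prop

theorem sum_range_antidiagonal_eq_sum_range_mul (F : ℕ → ℕ → ℂ) (r n M : ℕ) (hM : r + n ≤ M + 1)
    (h : ∀ j s, F j s ≠ 0 → j < r ∧ s < n) :
    ∑ l ∈ range M, ∑ x ∈ antidiagonal l, F x.1 x.2 = ∑ j ∈ range r, ∑ s ∈ range n, F j s := by
  rw [Finset.sum_sigma', ← Finset.sum_product']
  symm
  refine Finset.sum_bij_ne_zero (fun x _ _ => ⟨x.1 + x.2, x⟩) ?_ ?_ ?_ ?_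
  · intro x hx _
    simp only [mem_product, mem_range, mem_sigma, HasAntidiagonal.mem_antidiagonal] at hx ⊢
    exact ⟨by omega, trivial⟩
  · intro x _ _ y _ _ hxy
    simp at hxy
    exact hxy.2
  · rintro ⟨l, x⟩ hx h0
    simp only [mem_sigma, mem_range, HasAntidiagonal.mem_antidiagonal] at hx
    refine ⟨x, ?_, h0, ?_⟩
    · simpa using h _ _ h0
    · obtain ⟨_, rfl⟩ := hx
      rfl
  · intro x _ _
    rfl

/-- Repeated integration by parts of `(t + b) ^ n * g t` against a shifted exponential, with the
derivatives expanded by the Leibniz rule. -/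
theorem integral_add_pow_mul_polynomial_mul_exp (n r : ℕ) (g : Polynomial ℂ)
    (hg : g.natDegree < r) (b c : ℂ) (hc : c ≠ 0) :
    ∫ t in (0 : ℝ)..1, ((t : ℂ) + b) ^ n * g.eval (t : ℂ) * Complex.exp (-c * (t + b)) =
      (∑ j ∈ range r, ∑ s ∈ range (n + 1), ((j + s).choose j : ℂ) * (n.descFactorial s : ℂ) *
          b ^ (n - s) * (Polynomial.derivative^[j] g).eval 0 * Complex.exp (-c * b) /
            c ^ (j + s + 1)) -
      ∑ j ∈ range r, ∑ s ∈ range (n + 1), ((j + s).choose j : ℂ) * (n.descFactorial s : ℂ) *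
          (b + 1) ^ (n - s) * (Polynomial.derivative^[j] g).eval 1 * Complex.exp (-c * (b + 1)) /
            c ^ (j + s + 1) := by
  have hdeg : (((Polynomial.X + Polynomial.C b) ^ n) * g).natDegree < n + r := by
    refine lt_of_le_of_lt Polynomial.natDegree_mul_le ?_
    have : (((Polynomial.X + Polynomial.C b) ^ n)).natDegree ≤ n := by
      simp
    omega
  have h0 := integral_polynomial_mul_exp _ _ hdeg c hc
  have h1 : ∫ t in (0 : ℝ)..1, ((t : ℂ) + b) ^ n * g.eval (t : ℂ) * Complex.exp (-c * (t + b)) =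
      Complex.exp (-c * b) * ∫ t in (0 : ℝ)..1,
        (((Polynomial.X + Polynomial.C b) ^ n) * g).eval (t : ℂ) * Complex.exp (-c * t) := by
    rw [← intervalIntegral.integral_const_mul]
    congr 1
    ext t
    rw [mul_add, Complex.exp_add]
    simp
    ring
  have hD : ∀ (l : ℕ) (x : ℂ),
      (Polynomial.derivative^[l] (((Polynomial.X + Polynomial.C b) ^ n) * g)).eval x =
      ∑ y ∈ antidiagonal l, ((y.1 + y.2).choose y.1 : ℂ) * (n.descFactorial y.2 : ℂ) *
          (x + b) ^ (n - y.2) * (Polynomial.derivative^[y.1] g).eval x := by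
    intro l x
    rw [Polynomial.iterate_derivative_mul, Finset.Nat.sum_antidiagonal_eq_sum_range_succ_mk,
      Polynomial.eval_finsetSum]
    refine sum_congr rfl fun k hk => ?_
    have : k + (l - k) = l := by simp at hk; omega
    simp [Polynomial.iterate_derivative_X_add_pow, this]
    ring
  have hG : ∀ x : ℂ, ∑ l ∈ range (n + r),
      (Polynomial.derivative^[l] (((Polynomial.X + Polynomial.C b) ^ n) * g)).eval x / c ^ (l + 1) =
      ∑ j ∈ range r, ∑ s ∈ range (n + 1), ((j + s).choose j : ℂ) * (n.descFactorial s : ℂ) *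
          (x + b) ^ (n - s) * (Polynomial.derivative^[j] g).eval x / c ^ (j + s + 1) := by
    intro x
    rw [← sum_range_antidiagonal_eq_sum_range_mul _ r (n + 1) (n + r) (by omega)]
    · refine sum_congr rfl fun l _ => ?_
      rw [hD, Finset.sum_div]
      refine sum_congr rfl fun y hy => ?_
      rw [HasAntidiagonal.mem_antidiagonal] at hy
      rw [hy]
    · intro j s hne
      constructor
      · by_contra hj
        rw [Polynomial.iterate_derivative_eq_zero (by omega)] at hne
        simp at hne
      · by_contra hs
        rw [Nat.descFactorial_of_lt (by omega)] at hne
        simp at hne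
  rw [h1, h0]
  have e : ∀ (x E : ℂ), ∑ j ∈ range r, ∑ s ∈ range (n + 1), ((j + s).choose j : ℂ) *
      (n.descFactorial s : ℂ) * (x + b) ^ (n - s) * (Polynomial.derivative^[j] g).eval x * E /
        c ^ (j + s + 1) = E * ∑ l ∈ range (n + r),
      (Polynomial.derivative^[l] (((Polynomial.X + Polynomial.C b) ^ n) * g)).eval x /
        c ^ (l + 1) := by
    intro x E
    rw [hG, mul_sum]
    refine sum_congr rfl fun j _ => ?_
    rw [mul_sum]
    refine sum_congr rfl fun s _ => ?_
    ring
  have e0 := e 0 (Complex.exp (-c * b))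
  have e1 := e 1 (Complex.exp (-c * (b + 1)))
  simp only [zero_add, add_comm (1 : ℂ) b] at e0 e1
  rw [e0, e1, mul_add, mul_one, Complex.exp_add, mul_assoc, ← mul_sub]
  congr 1
  rw [mul_sum, ← Finset.sum_sub_distrib]
  refine sum_congr rfl fun l _ => ?_
  ring

theorem hasSum_of_eq_of_eq {ι : Type*} {f g : ι → ℂ} {a b : ℂ} (h : HasSum f a)
    (hfg : ∀ x, g x = f x) (hab : b = a) : HasSum g b :=
  hab ▸ h.congr_fun hfg

/-- Sum a family over `ℕ × ℕ` by splitting off the terms with second index `0`. -/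
theorem hasSum_prod_of_hasSum_zero_of_hasSum_succ {f : ℕ × ℕ → ℂ} {a b : ℂ}
    (h0 : HasSum (fun m => f (m, 0)) a) (h1 : HasSum (fun x : ℕ × ℕ => f (x.1, x.2 + 1)) b) :
    HasSum f (a + b) := by
  have i0 : Function.Injective (fun m : ℕ => (m, 0)) := fun x y h => by simpa using h
  have i1 : Function.Injective (fun x : ℕ × ℕ => (x.1, x.2 + 1)) := fun x y h => by
    simpa [Prod.ext_iff] using h
  have k0 : HasSum (fun x : ℕ × ℕ => if x.2 = 0 then f x else 0) a := by
    rw [← i0.hasSum_iff]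
    · simpa [Function.comp_def] using h0
    · rintro ⟨m, p⟩ h
      have : p ≠ 0 := by rintro rfl; exact h ⟨m, rfl⟩
      simp [this]
  have k1 : HasSum (fun x : ℕ × ℕ => if x.2 = 0 then 0 else f x) b := by
    rw [← i1.hasSum_iff]
    · simpa [Function.comp_def] using h1
    · rintro ⟨m, p⟩ h
      have : p = 0 := by
        by_contra hp
        exact h ⟨(m, p - 1), by simp; omega⟩
      simp [this]
  refine (k0.add k1).congr_fun ?_
  intro x
  by_cases h : x.2 = 0 <;> simp [h]

theorem summable_pow_mul_exp_lattice {c : ℂ} (hc : 0 < c.re) (s b : ℕ) {σ : ℝ} (hσ : 0 < σ) :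
    Summable fun x : ℕ × ℕ =>
      ((x.2 : ℂ) + b) ^ s * Complex.exp (-(c * (x.1 + 1)) * (x.2 + σ)) := by
  have h1 : Summable fun p : ℕ => ((p : ℝ) + b) ^ s * Real.exp (-c.re * p) := by
    have h := (summable_nat_add_iff b).2 (Real.summable_pow_mul_exp_neg_nat_mul s hc)
    refine (h.mul_left (Real.exp (c.re * b))).congr fun p => ?_
    rw [mul_left_comm, ← Real.exp_add]
    push_cast
    ring_nf
  have h2 : Summable fun m : ℕ => Real.exp (-(c.re * σ) * m) := by
    simpa using Real.summable_pow_mul_exp_neg_nat_mul 0 (mul_pos hc hσ)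
  have h3 := h2.mul_of_nonneg h1 (fun m => (Real.exp_pos _).le) (fun p => by positivity)
  refine Summable.of_norm_bounded h3 fun x => ?_
  have hb : ‖(x.2 : ℂ) + b‖ = (x.2 : ℝ) + b := by
    have : ((x.2 : ℂ) + b) = (((x.2 + b : ℕ) : ℝ) : ℂ) := by push_cast; rfl
    rw [this, Complex.norm_real, Real.norm_of_nonneg (by positivity)]
    push_cast; rfl
  rw [norm_mul, norm_pow, hb, Complex.norm_exp, mul_left_comm, ← Real.exp_add]
  refine mul_le_mul_of_nonneg_left (Real.exp_le_exp.2 ?_) (by positivity)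
  have : (-(c * ((x.1 : ℂ) + 1)) * ((x.2 : ℂ) + σ)).re =
      -(c.re * ((x.1 + 1) * (x.2 + σ))) := by
    have e : (-(c * ((x.1 : ℂ) + 1)) * ((x.2 : ℂ) + σ)) =
      -c * (((x.1 + 1) * (x.2 + σ) : ℝ) : ℂ) := by push_cast; ring
    rw [e, Complex.re_mul_ofReal, Complex.neg_re]
    ring
  rw [this]
  have : 0 ≤ c.re * (x.1 * x.2 + σ) := by positivity
  nlinarith

/-- The Kronecker coefficient `fKr (N + 1)` on the segment from `0` to `τ` as a double series. -/
theorem hasSum_fKr (N : ℕ) {τ : ℂ} (hτ : 0 < τ.im) {t : ℝ} (ht : t ∈ Set.Ioo (0 : ℝ) 1) :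
    HasSum (fun x : ℕ × ℕ =>
      (x.2 : ℂ) ^ N * Complex.exp (-(-(2 * π * Complex.I * τ) * (x.1 + 1)) * (x.2 + t)) +
      (-1) ^ (N + 1) * (((x.2 : ℂ) + 1) ^ N *
        Complex.exp (-(-(2 * π * Complex.I * τ) * (x.1 + 1)) * (x.2 + (1 - t)))))
      ((bernoulli (N + 1) : ℂ) / (N + 1) - fKr (N + 1) (τ * t) τ * N ! / (2 * π * Complex.I)) := by
  have hI : (2 * π * Complex.I : ℂ) ≠ 0 := Complex.two_pi_I_ne_zero
  have hc : 0 < (-(2 * π * Complex.I * τ)).re := by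
    have : (-(2 * π * Complex.I * τ)).re = 2 * π * τ.im := by simp
    rw [this]; positivity
  have s1 := summable_pow_mul_exp_lattice hc N 0 ht.1
  have s2 := summable_pow_mul_exp_lattice hc N 1 (sub_pos.2 ht.2)
  have s1' := summable_pow_mul_exp_lattice hc N 1 (add_pos one_pos ht.1)
  simp only [Nat.cast_zero, add_zero, Nat.cast_one, Complex.ofReal_sub, Complex.ofReal_one,
    Complex.ofReal_add] at s1 s2 s1'
  have hq : ∀ x : ℕ × ℕ, ∀ ε : ℂ, (Complex.exp (2 * ↑π * Complex.I * ((x.1 : ℂ) + 1) * (τ * t)) +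
      ε * Complex.exp (-(2 * ↑π * Complex.I * ((x.1 : ℂ) + 1) * (τ * t)))) *
        ((x.2 : ℂ) + 1) ^ N *
        Complex.exp (2 * ↑π * Complex.I * τ) ^ ((x.1 + 1) * (x.2 + 1)) =
      ((x.2 : ℂ) + 1) ^ N *
        Complex.exp (-(-(2 * π * Complex.I * τ) * (x.1 + 1)) * (x.2 + (1 + t))) +
      ε * (((x.2 : ℂ) + 1) ^ N *
        Complex.exp (-(-(2 * π * Complex.I * τ) * (x.1 + 1)) * (x.2 + (1 - t)))) := by
    intro x ε
    rw [← Complex.exp_nat_mul, mul_assoc, mul_left_comm, add_mul, mul_assoc ε, ← Complex.exp_add,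
      ← Complex.exp_add, mul_add, mul_left_comm _ ε]
    congr 5
    · push_cast; ring
    · push_cast; ring
  have hs2 := (s2.mul_left ((-1) ^ (N + 1))).hasSum
  have hsucc : (fun x : ℕ × ℕ => ((x.2 : ℂ) + 1) ^ N *
        Complex.exp (-(-(2 * π * Complex.I * τ) * (x.1 + 1)) * (x.2 + (1 + t)))) =
      fun x : ℕ × ℕ => (((x.2 + 1 : ℕ) : ℂ)) ^ N *
        Complex.exp (-(-(2 * π * Complex.I * τ) * (x.1 + 1)) * ((x.2 + 1 : ℕ) + t)) := by
    ext x
    push_cast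
    rw [add_assoc]
  have hs1 := s1'.hasSum
  rw [hsucc] at hs1
  cases N with
  | succ N =>
    have h1 := hasSum_prod_of_hasSum_zero_of_hasSum_succ
      (f := fun x : ℕ × ℕ => (x.2 : ℂ) ^ (N + 1) *
        Complex.exp (-(-(2 * π * Complex.I * τ) * (x.1 + 1)) * (x.2 + t)))
      (a := 0) (by simp) hs1
    convert h1.add hs2 using 1
    rw [← hsucc, zero_add, ← Summable.tsum_add s1' (s2.mul_left _)]
    simp only [fKr, hq]
    have : ((N + 1)! : ℂ) ≠ 0 := by exact_mod_cast Nat.factorial_ne_zero _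
    field_simp
    push_cast
    ring
  | zero =>
    have hz : 0 < (τ * t).im := by simpa using mul_pos hτ ht.1
    have hcot := pi_mul_cot_pi_q_exp ⟨τ * t, hz⟩
    simp only at hcot
    have hn : ‖Complex.exp (2 * π * Complex.I * (τ * t))‖ < 1 := by
      rw [Complex.norm_exp, Real.exp_lt_one_iff]
      have : (2 * π * Complex.I * (τ * t)).re = -(2 * π * (τ.im * t)) := by simp
      rw [this]
      have := ht.1
      simp only [Left.neg_neg_iff]
      positivity
    have hg := summable_geometric_of_norm_lt_one hn
    have h0 := (summable_nat_add_iff 1).2 hg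
    rw [hg.tsum_eq_zero_add] at hcot
    have h1 := hasSum_prod_of_hasSum_zero_of_hasSum_succ
      (f := fun x : ℕ × ℕ => (x.2 : ℂ) ^ 0 *
        Complex.exp (-(-(2 * π * Complex.I * τ) * (x.1 + 1)) * (x.2 + t)))
      (h0.hasSum.congr_fun (fun m => by
        rw [← Complex.exp_nat_mul]; push_cast; ring_nf)) hs1
    convert h1.add hs2 using 1
    rw [← hsucc, add_assoc, ← Summable.tsum_add s1' (s2.mul_left _)]
    have e : ∀ x : ℕ × ℕ, _ := fun x => hq x (-1)
    simp only [pow_zero, mul_one, neg_one_mul, ← sub_eq_add_neg] at e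
    simp only [fKr, hcot, e]
    simp
    field_simp
    ring_nf

/-- The lattice-type double series of `omKr (N + 1)` on the segment from `0` to `τ`. -/
theorem hasSum_omKr (N : ℕ) {τ : ℂ} (hτ : 0 < τ.im) {t : ℝ} (ht : t ∈ Set.Ioo (0 : ℝ) 1) :
    HasSum (fun x : ℕ × ℕ =>
      ((x.2 : ℂ) + t) ^ N *
        Complex.exp (-(-(2 * π * Complex.I * τ) * (x.1 + 1)) * (x.2 + t)) +
      (-1) ^ (N + 1) * (((x.2 : ℂ) + (1 - t)) ^ N *
        Complex.exp (-(-(2 * π * Complex.I * τ) * (x.1 + 1)) * (x.2 + (1 - t)))))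
      (N ! * (∑ k ∈ range (N + 2), (bernoulli k : ℂ) * t ^ (N + 1 - k) / (k ! * (N + 1 - k)!) -
        omKr (N + 1) (τ * t) τ / (2 * π * Complex.I))) := by
  have hI : (2 * π * Complex.I : ℂ) ≠ 0 := Complex.two_pi_I_ne_zero
  have h := hasSum_sum (s := range (N + 1))
    (fun k (_ : k ∈ range (N + 1)) =>
      (hasSum_fKr (N - k) hτ ht).mul_left ((N.choose k : ℂ) * (t : ℂ) ^ k))
  refine hasSum_of_eq_of_eq h (fun x => ?_) ?_
  · generalize Complex.exp (-(-(2 * π * Complex.I * τ) * (x.1 + 1)) * (x.2 + t)) = E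
    generalize Complex.exp (-(-(2 * π * Complex.I * τ) * (x.1 + 1)) * (x.2 + (1 - t))) = E'
    simp only [mul_add _ (_ * E), sum_add_distrib]
    congr 1
    · rw [add_comm (x.2 : ℂ) t, add_pow, sum_mul]
      refine sum_congr rfl fun k _ => ?_
      ring
    · have : (x.2 : ℂ) + (1 - t) = -t + (x.2 + 1) := by ring
      conv_lhs => enter [2, 1]; rw [this, add_pow]
      rw [sum_mul, mul_sum]
      refine sum_congr rfl fun k hk => ?_
      have hk : k ≤ N := by simp at hk; omega
      obtain ⟨d, rfl⟩ := Nat.exists_eq_add_of_le hk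
      have e : (-1 : ℂ) ^ (k + d + 1) * (-t : ℂ) ^ k = (-1) ^ (d + 1) * t ^ k := by
        rw [neg_pow (t : ℂ) k, ← mul_assoc, ← pow_add, show k + d + 1 + k = 2 * k + (d + 1) by ring,
          pow_add, pow_mul]
        simp
      simp only [Nat.add_sub_cancel_left]
      linear_combination (((x.2 : ℂ) + 1) ^ d * ((k + d).choose k : ℂ) *
        E') * e
  · have him : (τ * t).im / τ.im = t := by
      simp
      field_simp
    have ho : omKr (N + 1) (τ * t) τ = ∑ k ∈ range (N + 1), ((t ^ k / (k ! : ℝ) : ℝ) : ℂ) *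
        fKr (N + 1 - k) (τ * t) τ + ((t ^ (N + 1) / ((N + 1)! : ℝ) : ℝ) : ℂ) *
        fKr (N + 1 - (N + 1)) (τ * t) τ := by
      rw [omKr, sum_range_succ, him]
    rw [sum_range_succ', ho]
    have hf : ∀ k, (k ! : ℂ) ≠ 0 := fun k => by exact_mod_cast Nat.factorial_ne_zero _
    have h1 : ∀ k ∈ range (N + 1), (N.choose k : ℂ) = N ! / (k ! * (N - k)!) := by
      intro k hk
      have hk : k ≤ N := by simp at hk; omega
      rw [Nat.cast_choose ℂ hk]
    simp only [mul_sub, sum_sub_distrib]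
    rw [← sum_range_reflect (fun k => (bernoulli (k + 1) : ℂ) * (t : ℂ) ^ (N + 1 - (k + 1)) /
      ((k + 1)! * (N + 1 - (k + 1))!)), mul_add, mul_sum, add_div, mul_add, sum_div, mul_sum]
    have h2 : ∑ k ∈ range (N + 1), (N ! : ℂ) *
        ((bernoulli (N + 1 - 1 - k + 1) : ℂ) * t ^ (N + 1 - (N + 1 - 1 - k + 1)) /
          ((N + 1 - 1 - k + 1)! * (N + 1 - (N + 1 - 1 - k + 1))!)) =
        ∑ k ∈ range (N + 1), (N.choose k : ℂ) * (t : ℂ) ^ k *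
          ((bernoulli (N - k + 1) : ℂ) / ((N - k : ℕ) + 1)) := by
      refine sum_congr rfl fun k hk => ?_
      rw [h1 k hk]
      have hk : k ≤ N := by simp at hk; omega
      have : N + 1 - (N + 1 - 1 - k + 1) = k := by omega
      rw [this, Nat.add_sub_cancel, Nat.factorial_succ]
      have := hf k
      have := hf (N - k)
      have : ((N - k : ℕ) : ℂ) + 1 ≠ 0 := Nat.cast_add_one_ne_zero _
      push_cast
      field_simp
    have h3 : ∑ k ∈ range (N + 1), (N ! : ℂ) * ((((t ^ k / (k ! : ℝ) : ℝ) : ℂ) *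
          fKr (N + 1 - k) (τ * t) τ) / (2 * π * Complex.I)) =
        ∑ k ∈ range (N + 1), (N.choose k : ℂ) * (t : ℂ) ^ k *
          (fKr (N - k + 1) (τ * t) τ * (N - k)! / (2 * π * Complex.I)) := by
      refine sum_congr rfl fun k hk => ?_
      rw [h1 k hk]
      have hk : k ≤ N := by simp at hk; omega
      have : N + 1 - k = N - k + 1 := by omega
      rw [this]
      have := hf k
      have := hf (N - k)
      push_cast
      field_simp
    rw [h2, h3]
    have := hf (N + 1)
    simp [fKr]

/-- The boundary contribution at the integer `x.2` of the repeated integration by parts of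
`(u ^ N) g(u - ⌊u⌋) exp (-c (x.1 + 1) u)`, where `v j` is the one-sided limit of `g⁽ʲ⁾`. -/
noncomputable def boundaryTerm (N r : ℕ) (c : ℂ) (v : ℕ → ℂ) (x : ℕ × ℕ) : ℂ :=
  ∑ j ∈ range r, ∑ s ∈ range (N + 1), ((j + s).choose j : ℂ) * (N.descFactorial s : ℂ) *
    (x.2 : ℂ) ^ (N - s) * v j * Complex.exp (-(c * (x.1 + 1)) * x.2) /
      (c * (x.1 + 1)) ^ (j + s + 1)

/-- The double series `∑ (x.2 + 1) ^ a (x.1 + 1) ^ (-b) exp (-c (x.1 + 1) (x.2 + 1))`. -/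
noncomputable def expLatticeSum (c : ℂ) (a b : ℕ) : ℂ :=
  ∑' x : ℕ × ℕ, ((x.2 : ℂ) + 1) ^ a * Complex.exp (-(c * (x.1 + 1)) * (x.2 + 1)) /
    ((x.1 : ℂ) + 1) ^ b

theorem hasSum_expLatticeSum {c : ℂ} (hc : 0 < c.re) (a b : ℕ) :
    HasSum (fun x : ℕ × ℕ => ((x.2 : ℂ) + 1) ^ a * Complex.exp (-(c * (x.1 + 1)) * (x.2 + 1)) /
      ((x.1 : ℂ) + 1) ^ b) (expLatticeSum c a b) := by
  have h := summable_pow_mul_exp_lattice hc a 1 one_pos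
  simp only [Nat.cast_one, Complex.ofReal_one] at h
  refine (Summable.of_norm_bounded h.norm fun x => ?_).hasSum
  rw [norm_div]
  refine div_le_self (norm_nonneg _) ?_
  rw [norm_pow]
  refine one_le_pow₀ ?_
  have : ((x.1 : ℂ) + 1) = ((x.1 + 1 : ℕ) : ℂ) := by push_cast; rfl
  rw [this, Complex.norm_natCast]
  exact_mod_cast Nat.le_add_left 1 _

theorem hasSum_boundaryTerm_succ (N r : ℕ) {c : ℂ} (hc : 0 < c.re) (v : ℕ → ℂ) :
    HasSum (fun x : ℕ × ℕ => boundaryTerm N r c v (x.1, x.2 + 1))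
      (∑ j ∈ range r, ∑ s ∈ range (N + 1), ((j + s).choose j : ℂ) * (N.descFactorial s : ℂ) *
        v j / c ^ (j + s + 1) * expLatticeSum c (N - s) (j + s + 1)) := by
  refine hasSum_of_eq_of_eq (hasSum_sum fun j _ => hasSum_sum fun s _ =>
    (hasSum_expLatticeSum hc (N - s) (j + s + 1)).mul_left (((j + s).choose j : ℂ) *
      (N.descFactorial s : ℂ) * v j / c ^ (j + s + 1))) (fun x => ?_) rfl
  refine sum_congr rfl fun j _ => sum_congr rfl fun s _ => ?_
  push_cast
  rw [mul_pow]
  generalize ((x.1 : ℂ) + 1) ^ (j + s + 1) = D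
  generalize c ^ (j + s + 1) = D'
  simp only [div_eq_mul_inv, mul_inv]
  ring

theorem hasSum_one_div_nat_add_one_pow {k : ℕ} (hk : 1 < k) :
    HasSum (fun m : ℕ => 1 / ((m : ℂ) + 1) ^ k) (riemannZeta k) := by
  have hs : Summable (fun n : ℕ => 1 / (n : ℂ) ^ k) := by
    have := Complex.summable_one_div_nat_cpow (p := k)
    simp only [Complex.cpow_natCast, Complex.natCast_re] at this
    exact this.2 (by exact_mod_cast hk)
  rw [zeta_nat_eq_tsum_of_gt_one hk, hs.tsum_eq_zero_add]
  have h1 := ((summable_nat_add_iff 1).2 hs).hasSum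
  simp only [Nat.cast_add, Nat.cast_one] at h1 ⊢
  rwa [Nat.cast_zero, zero_pow (by omega), div_zero, zero_add]

theorem hasSum_boundaryTerm_zero {N : ℕ} (hN : 1 ≤ N) (r : ℕ) (c : ℂ) (v : ℕ → ℂ) :
    HasSum (fun m : ℕ => boundaryTerm N r c v (m, 0))
      (∑ j ∈ range r, ((j + N).choose j : ℂ) * (N ! : ℂ) *
        v j / c ^ (j + N + 1) * riemannZeta ((j + N + 1 : ℕ) : ℂ)) := by
  refine hasSum_of_eq_of_eq (hasSum_sum fun j _ =>
    (hasSum_one_div_nat_add_one_pow (k := j + N + 1) (by omega)).mul_left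
      (((j + N).choose j : ℂ) * (N ! : ℂ) * v j / c ^ (j + N + 1))) (fun m => ?_) rfl
  refine sum_congr rfl fun j _ => ?_
  rw [sum_range_succ, sum_eq_zero]
  · simp only [Nat.descFactorial_self, Nat.sub_self, pow_zero, Nat.cast_zero, mul_zero,
      Complex.exp_zero, zero_add, mul_one, mul_pow]
    generalize ((m : ℂ) + 1) ^ (j + N + 1) = D
    generalize c ^ (j + N + 1) = D'
    simp only [div_eq_mul_inv, mul_inv]
    ring
  · intro s hs
    have : N - s ≠ 0 := by simp at hs; omega
    simp [this]

/-- Integrating a lattice series against a polynomial gives zeta values, from the boundary terms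
at `0`, and the double series `expLatticeSum`. -/
theorem hasSum_integral_lattice {N : ℕ} (hN : 1 ≤ N) (r : ℕ) {c : ℂ} (hc : 0 < c.re)
    (g : Polynomial ℂ) (hg : g.natDegree < r) :
    HasSum (fun x : ℕ × ℕ => ∫ t in (0 : ℝ)..1, ((t : ℂ) + x.2) ^ N * g.eval (t : ℂ) *
        Complex.exp (-(c * (x.1 + 1)) * (t + x.2)))
      ((∑ j ∈ range r, ((j + N).choose j : ℂ) * (N ! : ℂ) *
        (Polynomial.derivative^[j] g).eval 0 / c ^ (j + N + 1) *
          riemannZeta ((j + N + 1 : ℕ) : ℂ)) +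
      ∑ j ∈ range r, ∑ s ∈ range (N + 1), ((j + s).choose j : ℂ) * (N.descFactorial s : ℂ) *
        ((Polynomial.derivative^[j] g).eval 0 - (Polynomial.derivative^[j] g).eval 1) /
          c ^ (j + s + 1) * expLatticeSum c (N - s) (j + s + 1)) := by
  have h0 := hasSum_prod_of_hasSum_zero_of_hasSum_succ
    (hasSum_boundaryTerm_zero hN r c fun j => (Polynomial.derivative^[j] g).eval 0)
    (hasSum_boundaryTerm_succ N r hc fun j => (Polynomial.derivative^[j] g).eval 0)
  have h1 := hasSum_boundaryTerm_succ N r hc fun j => (Polynomial.derivative^[j] g).eval 1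
  refine hasSum_of_eq_of_eq (h0.sub h1) (fun x => ?_) ?_
  · have hc0 : c ≠ 0 := by rintro rfl; simp at hc
    rw [integral_add_pow_mul_polynomial_mul_exp N r g hg _ _
      (mul_ne_zero hc0 (Nat.cast_add_one_ne_zero _))]
    simp only [boundaryTerm]
    push_cast
    rfl
  · rw [add_sub_assoc, ← sum_sub_distrib]
    congr 1
    refine sum_congr rfl fun j _ => ?_
    rw [← sum_sub_distrib]
    refine sum_congr rfl fun s _ => ?_
    ring

theorem summable_integral_pow_mul_exp_lattice {N : ℕ} (hN : 1 ≤ N) {a : ℝ} (ha : 0 < a) :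
    Summable fun x : ℕ × ℕ => ∫ t in (0 : ℝ)..1, (t + x.2) ^ N *
      Real.exp (-(a * (x.1 + 1)) * (t + x.2)) := by
  rw [← Complex.summable_ofReal]
  refine (hasSum_integral_lattice hN 1 (c := a) (by simpa) 1 (by simp)).summable.congr fun x => ?_
  rw [← intervalIntegral.integral_ofReal]
  congr 1
  ext t
  push_cast
  simp

theorem hasSum_option {ι : Type*} {f : Option ι → ℂ} {a : ℂ} (h : HasSum (fun i => f (some i)) a) :
    HasSum f (f none + a) := by
  classical
  have h1 : HasSum (fun i : Option ι => if i = none then f none else 0) (f none) :=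
    hasSum_ite_eq none _
  have h2 : HasSum (fun i : Option ι => if i = none then 0 else f i) a := by
    rw [← (Option.some_injective ι).hasSum_iff]
    · simpa [Function.comp_def] using h
    · intro i hi
      cases i with
      | none => simp
      | some i => exact absurd ⟨i, rfl⟩ hi
  refine (h1.add h2).congr_fun fun i => ?_
  cases i <;> simp

theorem summable_option {ι : Type*} {f : Option ι → ℝ} (h : Summable fun i => f (some i)) :
    Summable f := by
  rw [← Complex.summable_ofReal] at h ⊢
  exact (hasSum_option (f := fun i => (f i : ℂ)) h.hasSum).summable

/-- The case of `hasSum_integral_lattice` for the monomial `t ^ R` symmetrized under `t ↦ 1 - t`. -/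
theorem hasSum_integral_lattice_symm {N : ℕ} (hN : 1 ≤ N) (R : ℕ) {c : ℂ} (hc : 0 < c.re) :
    HasSum (fun x : ℕ × ℕ => ∫ t in (0 : ℝ)..1, (t : ℂ) ^ R * (((x.2 : ℂ) + t) ^ N *
        Complex.exp (-(c * (x.1 + 1)) * (x.2 + t)) +
      (-1) ^ (N + 1) * (((x.2 : ℂ) + (1 - t)) ^ N *
        Complex.exp (-(c * (x.1 + 1)) * (x.2 + (1 - t))))))
      ((∑ j ∈ range (R + 1), ((j + N).choose j : ℂ) * (N ! : ℂ) *
        ((R.descFactorial j : ℂ) * (0 ^ (R - j) + (-1) ^ (N + 1 + j))) / c ^ (j + N + 1) *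
          riemannZeta ((j + N + 1 : ℕ) : ℂ)) +
      ∑ j ∈ range R, ∑ s ∈ range (N + 1), ((j + s).choose j : ℂ) * (N.descFactorial s : ℂ) *
        ((R.descFactorial j : ℂ) * (-1 + (-1) ^ (N + 1 + j))) /
          c ^ (j + s + 1) * expLatticeSum c (N - s) (j + s + 1)) := by
  set g : Polynomial ℂ := Polynomial.X ^ R +
    Polynomial.C ((-1) ^ (N + 1)) * (Polynomial.X ^ R).comp (1 - Polynomial.X) with hgdef
  have hg : g.natDegree < R + 1 := by
    rw [Nat.lt_succ_iff, hgdef]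
    refine Polynomial.natDegree_add_le_of_degree_le (by simp) ?_
    refine (Polynomial.natDegree_C_mul_le _ _).trans ?_
    refine Polynomial.natDegree_comp_le.trans ?_
    rw [Polynomial.natDegree_X_pow]
    have : (1 - Polynomial.X : Polynomial ℂ).natDegree ≤ 1 := by
      refine (Polynomial.natDegree_sub_le _ _).trans (by simp)
    nlinarith
  have hD : ∀ (j : ℕ) (x : ℂ), (Polynomial.derivative^[j] g).eval x =
      (R.descFactorial j : ℂ) * (x ^ (R - j) + (-1) ^ (N + 1 + j) * (1 - x) ^ (R - j)) := by
    intro j x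
    rw [hgdef, iterate_map_add, Polynomial.iterate_derivative_C_mul,
      Polynomial.iterate_derivative_comp_one_sub_X, Polynomial.iterate_derivative_X_pow_eq_smul]
    simp
    ring
  refine hasSum_of_eq_of_eq (hasSum_integral_lattice hN (R + 1) hc g hg) (fun x => ?_) ?_
  · have h1 : ∫ t in (0 : ℝ)..1, (t : ℂ) ^ R * ((-1) ^ (N + 1) * (((x.2 : ℂ) + (1 - t)) ^ N *
        Complex.exp (-(c * (x.1 + 1)) * (x.2 + (1 - t))))) =
        ∫ t in (0 : ℝ)..1, (1 - (t : ℂ)) ^ R * ((-1) ^ (N + 1) * (((x.2 : ℂ) + t) ^ N *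
        Complex.exp (-(c * (x.1 + 1)) * (x.2 + t)))) := by
      have := intervalIntegral.integral_comp_sub_left (a := 0) (b := 1) (fun t : ℝ =>
        (1 - (t : ℂ)) ^ R * ((-1) ^ (N + 1) * (((x.2 : ℂ) + t) ^ N *
        Complex.exp (-(c * (x.1 + 1)) * (x.2 + t))))) 1
      simpa using this
    simp only [mul_add ((_ : ℂ) ^ R)]
    rw [intervalIntegral.integral_add, h1, ← intervalIntegral.integral_add]
    · congr 1
      ext t
      have := hD 0 t
      simp only [Function.iterate_zero, id] at this
      rw [this, add_comm (t : ℂ)]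
      simp
      ring
    all_goals
      apply Continuous.intervalIntegrable
      fun_prop
  · simp only [hD]
    congr 1
    · simp
    · rw [sum_range_succ]
      have e0 : ∀ s, ((R + s).choose R : ℂ) * (N.descFactorial s : ℂ) *
          ((R.descFactorial R : ℂ) * (0 ^ (R - R) + (-1) ^ (N + 1 + R) * (1 - 0) ^ (R - R)) -
            (R.descFactorial R : ℂ) * (1 ^ (R - R) + (-1) ^ (N + 1 + R) * (1 - 1) ^ (R - R))) /
          c ^ (R + s + 1) * expLatticeSum c (N - s) (R + s + 1) = 0 := by
        intro s
        simp
      rw [sum_eq_zero fun s _ => e0 s, add_zero]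
      refine sum_congr rfl fun j hj => sum_congr rfl fun s _ => ?_
      have : R - j ≠ 0 := by simp at hj; omega
      rw [zero_pow this, sub_self, zero_pow this]
      simp only [sub_zero, one_pow]
      ring

theorem sum_alternating_factorial_mul_sum_Icc (N j : ℕ) (w : ℕ → ℂ) :
    ∑ i ∈ range (j + 1), ((-1 : ℂ) ^ (j - i) * ((N + i)! : ℂ) / ((i ! : ℂ) * ((j - i)! : ℂ))) *
        ∑ k ∈ Icc 1 (N + i + 1), w k / ((N + i + 1 - k)! : ℂ) =
      ∑ s ∈ range (N + 1), ((j + s).choose j : ℂ) * (N.descFactorial s : ℂ) * w (j + s + 1) := by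
  have hf : ∀ k, (k ! : ℂ) ≠ 0 := fun k => by exact_mod_cast Nat.factorial_ne_zero _
  have h1 : ∀ i ∈ range (j + 1), ((-1 : ℂ) ^ (j - i) * ((N + i)! : ℂ) /
      ((i ! : ℂ) * ((j - i)! : ℂ))) * ∑ k ∈ Icc 1 (N + i + 1), w k / ((N + i + 1 - k)! : ℂ) =
      ∑ k ∈ range (j + (N + 1)), (-1 : ℂ) ^ (j - i) * (j.choose i : ℂ) *
        ((N + i).descFactorial k : ℂ) * (w (k + 1) / j !) := by
    intro i hi
    have hi : i ≤ j := by simp at hi; omega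
    rw [← sum_subset (range_subset_range.2 (show N + i + 1 ≤ j + (N + 1) by omega)),
      ← Finset.Ico_add_one_right_eq_Icc, Finset.sum_Ico_eq_sum_range, mul_sum]
    · refine sum_congr (by simp) fun k hk => ?_
      have hk : k ≤ N + i := by simp at hk; omega
      have e1 : N + i + 1 - (1 + k) = N + i - k := by omega
      have e2 : ((N + i).descFactorial k : ℂ) = (N + i)! / (N + i - k)! := by
        rw [eq_div_iff (hf _), mul_comm]
        exact_mod_cast Nat.factorial_mul_descFactorial hk
      rw [e1, e2, Nat.cast_choose ℂ hi, add_comm 1 k]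
      have := hf j
      have := hf i
      have := hf (j - i)
      have := hf (N + i - k)
      field_simp
    · intro k _ hk
      rw [Nat.descFactorial_of_lt (by simp at hk; omega)]
      simp
  rw [sum_congr rfl h1, sum_comm]
  simp only [← sum_mul]
  rw [sum_congr rfl fun k _ => by rw [sum_alternating_choose_mul_descFactorial j N k],
    sum_range_add]
  have h2 : ∀ k ∈ range j, (k.descFactorial j : ℂ) * (N.descFactorial (k - j) : ℂ) *
      (w (k + 1) / j !) = 0 := by
    intro k hk
    rw [Nat.descFactorial_of_lt (by simpa using hk)]
    simp
  rw [sum_eq_zero h2, zero_add]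
  refine sum_congr rfl fun s _ => ?_
  rw [Nat.descFactorial_eq_factorial_mul_choose, Nat.add_sub_cancel_left]
  have := hf j
  push_cast
  field_simp

/-- `GammaEis` as a multiple of `expLatticeSum`. -/
theorem GammaEis_eq_expLatticeSum (N j s : ℕ) (hs : s ≤ N) (τ : ℂ) :
    GammaEis (N + j + 2) (j + s + 1) τ = -((1 + (-1 : ℂ) ^ (N + j)) / ((N + j + 1)! : ℂ)) *
      expLatticeSum (-(2 * π * Complex.I * τ)) (N - s) (j + s + 1) := by
  rw [GammaEis, expLatticeSum, ← (Equiv.prodComm ℕ ℕ).tsum_eq]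
  congr 1
  · rw [pow_add]
    simp
  · refine tsum_congr fun x => ?_
    have e : (((N + j + 2 : ℕ) : ℤ) - ((j + s + 1 : ℕ) : ℤ) - 1) = ((N - s : ℕ) : ℤ) := by
      push_cast [hs]; ring
    rw [e, zpow_natCast, zpow_neg, zpow_natCast, ← Complex.exp_nat_mul]
    simp only [Equiv.prodComm_apply, Prod.fst_swap, Prod.snd_swap]
    rw [div_eq_mul_inv, mul_right_comm]
    push_cast
    congr 3
    ring

/-- Term-by-term integration of `omKr (N + 1)` against a power of `t`. -/
theorem integral_pow_mul_omKr (N R : ℕ) (hN : 1 ≤ N) {τ : ℂ} (hτ : 0 < τ.im) {S : ℂ}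
    (hS : HasSum (fun x : ℕ × ℕ => ∫ t in (0 : ℝ)..1, (t : ℂ) ^ R * (((x.2 : ℂ) + t) ^ N *
        Complex.exp (-(-(2 * π * Complex.I * τ) * (x.1 + 1)) * (x.2 + t)) +
      (-1) ^ (N + 1) * (((x.2 : ℂ) + (1 - t)) ^ N *
        Complex.exp (-(-(2 * π * Complex.I * τ) * (x.1 + 1)) * (x.2 + (1 - t)))))) S) :
    ∫ t in Set.Ioo (0 : ℝ) 1, ((2 * π * Complex.I * (t : ℂ)) ^ R / (R ! : ℂ)) *
        omKr (N + 1) (τ * (t : ℂ)) τ =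
      (2 * π * Complex.I) ^ (R + 1) / (R ! : ℂ) *
        ((∑ k ∈ range (N + 2), (bernoulli k : ℂ) /
          ((k ! : ℂ) * ((N + 1 - k)! : ℂ) * ((N + 1 - k + (R + 1) : ℕ) : ℂ))) - S / N !) := by
  have hI : (2 * π * Complex.I : ℂ) ≠ 0 := Complex.two_pi_I_ne_zero
  have hNf : (N ! : ℂ) ≠ 0 := by exact_mod_cast Nat.factorial_ne_zero _
  set c : ℂ := -(2 * π * Complex.I * τ) with hcdef
  have hc : 0 < c.re := by
    have : c.re = 2 * π * τ.im := by simp [hcdef]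
    rw [this]; positivity
  set P : ℝ → ℂ := fun t => ∑ k ∈ range (N + 2),
    (bernoulli k : ℂ) / (k ! * (N + 1 - k)!) * (t : ℂ) ^ (N + 1 - k + R) with hP
  set H : ℕ × ℕ → ℝ → ℂ := fun x t => (t : ℂ) ^ R * (((x.2 : ℂ) + t) ^ N *
        Complex.exp (-(c * (x.1 + 1)) * (x.2 + t)) +
      (-1) ^ (N + 1) * (((x.2 : ℂ) + (1 - t)) ^ N *
        Complex.exp (-(c * (x.1 + 1)) * (x.2 + (1 - t))))) with hH
  set F : Option (ℕ × ℕ) → ℝ → ℂ := fun o t => o.elim (P t) fun x => -(H x t) / N ! with hF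
  have hIoo : ∀ f : ℝ → ℂ, ∫ t in Set.Ioo (0 : ℝ) 1, f t = ∫ t in (0 : ℝ)..1, f t := by
    intro f
    rw [intervalIntegral.integral_of_le zero_le_one, integral_Ioc_eq_integral_Ioo]
  have hIoo' : ∀ f : ℝ → ℝ, ∫ t in Set.Ioo (0 : ℝ) 1, f t = ∫ t in (0 : ℝ)..1, f t := by
    intro f
    rw [intervalIntegral.integral_of_le zero_le_one, integral_Ioc_eq_integral_Ioo]
  have hintegrable : ∀ f : ℝ → ℂ, Continuous f → Integrable f (volume.restrict (Set.Ioo (0 : ℝ) 1)) :=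
    fun f hf => (hf.integrableOn_Icc (a := 0) (b := 1)).mono_set Set.Ioo_subset_Icc_self
  have hintegrable' : ∀ f : ℝ → ℝ, Continuous f → Integrable f (volume.restrict (Set.Ioo (0 : ℝ) 1)) :=
    fun f hf => (hf.integrableOn_Icc (a := 0) (b := 1)).mono_set Set.Ioo_subset_Icc_self
  have hHc : ∀ x, Continuous (H x) := fun x => by rw [hH]; fun_prop
  have hPc : Continuous P := by rw [hP]; fun_prop
  have hFc : ∀ o, Continuous (F o) := by
    rintro (_ | x)
    · exact hPc
    · exact (hHc x).neg.div_const _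
  have hnorm : ∀ (x : ℕ × ℕ) (u : ℝ), 0 ≤ u → ‖((x.2 : ℂ) + u) ^ N *
      Complex.exp (-(c * (x.1 + 1)) * (x.2 + u))‖ =
      (u + x.2) ^ N * Real.exp (-(c.re * (x.1 + 1)) * (u + x.2)) := by
    intro x u hu
    have e1 : (x.2 : ℂ) + u = ((u + x.2 : ℝ) : ℂ) := by push_cast; ring
    have e2 : -(c * ((x.1 : ℂ) + 1)) * ((u + x.2 : ℝ) : ℂ) =
      -c * (((x.1 + 1) * (u + x.2) : ℝ) : ℂ) := by push_cast; ring
    rw [e1, e2, norm_mul, norm_pow, Complex.norm_real, Real.norm_of_nonneg (by positivity),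
      Complex.norm_exp, Complex.re_mul_ofReal, Complex.neg_re]
    ring_nf
  have hbound : ∀ x : ℕ × ℕ, ∫ t in Set.Ioo (0 : ℝ) 1, ‖H x t‖ ≤
      2 * ∫ t in (0 : ℝ)..1, (t + x.2) ^ N * Real.exp (-(c.re * (x.1 + 1)) * (t + x.2)) := by
    intro x
    set h : ℝ → ℝ := fun t => (t + x.2) ^ N * Real.exp (-(c.re * (x.1 + 1)) * (t + x.2)) with hh
    have hhc : Continuous h := by rw [hh]; fun_prop
    have h1 : ∫ t in (0 : ℝ)..1, h (1 - t) = ∫ t in (0 : ℝ)..1, h t := by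
      simp
    have h2 : 2 * ∫ t in (0 : ℝ)..1, h t = ∫ t in Set.Ioo (0 : ℝ) 1, (h t + h (1 - t)) := by
      rw [hIoo', intervalIntegral.integral_add, h1, two_mul]
      · exact hhc.intervalIntegrable _ _
      · exact (hhc.comp (by fun_prop : Continuous fun t : ℝ => 1 - t)).intervalIntegrable _ _
    rw [h2]
    refine setIntegral_mono_on (hintegrable' _ (hHc x).norm) (hintegrable' _ (by fun_prop)) measurableSet_Ioo
      fun t ht => ?_
    have k1 := hnorm x t ht.1.le
    have k2 := hnorm x (1 - t) (sub_nonneg.2 ht.2.le)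
    rw [Complex.ofReal_sub, Complex.ofReal_one] at k2
    have k3 : ‖(t : ℂ) ^ R‖ ≤ 1 := by
      rw [norm_pow, Complex.norm_real, Real.norm_of_nonneg ht.1.le]
      exact pow_le_one₀ ht.1.le ht.2.le
    simp only [hH]
    rw [norm_mul]
    refine (mul_le_of_le_one_left (norm_nonneg _) k3).trans ((norm_add_le _ _).trans ?_)
    rw [norm_mul ((-1 : ℂ) ^ (N + 1)), norm_pow, norm_neg, norm_one, one_pow, one_mul, k1, k2]
  have hsumH : Summable fun x : ℕ × ℕ => ∫ t in Set.Ioo (0 : ℝ) 1, ‖H x t‖ :=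
    Summable.of_nonneg_of_le (fun x => integral_nonneg fun t => norm_nonneg _) hbound
      ((summable_integral_pow_mul_exp_lattice hN hc).mul_left 2)
  have hsumF : Summable fun o => ∫ t in Set.Ioo (0 : ℝ) 1, ‖F o t‖ := by
    refine summable_option ((hsumH.div_const ‖(N ! : ℂ)‖).congr fun x => ?_)
    rw [← integral_div]
    congr 1
    ext t
    simp [hF]
  have h1 := hasSum_integral_of_summable_integral_norm (fun o => hintegrable _ (hFc o)) hsumF
  have h2 : HasSum (fun o => ∫ t in Set.Ioo (0 : ℝ) 1, F o t)
      ((∫ t in Set.Ioo (0 : ℝ) 1, P t) + -S / N !) := by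
    refine hasSum_option (f := fun o => ∫ t in Set.Ioo (0 : ℝ) 1, F o t) ?_
    refine (hS.neg.div_const (N ! : ℂ)).congr_fun fun x => ?_
    simp only [hF, Option.elim]
    rw [integral_div, integral_neg, hIoo]
  have hPint : ∫ t in Set.Ioo (0 : ℝ) 1, P t = ∑ k ∈ range (N + 2), (bernoulli k : ℂ) /
          ((k ! : ℂ) * ((N + 1 - k)! : ℂ) * ((N + 1 - k + (R + 1) : ℕ) : ℂ)) := by
    rw [hIoo, hP, intervalIntegral.integral_finsetSum]
    · refine sum_congr rfl fun k _ => ?_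
      rw [intervalIntegral.integral_const_mul]
      have : ∫ t in (0 : ℝ)..1, (t : ℂ) ^ (N + 1 - k + R) =
          1 / ((N + 1 - k + (R + 1) : ℕ) : ℂ) := by
        simp only [← Complex.ofReal_pow]
        rw [intervalIntegral.integral_ofReal, integral_pow]
        push_cast
        simp [add_assoc]
      rw [this, div_mul_div_comm, mul_one]
    · intro k _
      apply Continuous.intervalIntegrable
      fun_prop
  rw [← hPint, sub_eq_add_neg, ← neg_div, h2.unique h1, ← integral_const_mul]
  refine setIntegral_congr_fun measurableSet_Ioo fun t ht => ?_
  have h3 := hasSum_option (f := fun o => F o t) (((hasSum_omKr N hτ ht).mul_left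
    ((t : ℂ) ^ R)).neg.div_const (N ! : ℂ))
  rw [h3.tsum_eq]
  have hPt : P t = (t : ℂ) ^ R * ∑ k ∈ range (N + 2),
      (bernoulli k : ℂ) * t ^ (N + 1 - k) / (k ! * (N + 1 - k)!) := by
    rw [hP, mul_sum]
    refine sum_congr rfl fun k _ => ?_
    rw [pow_add]
    ring
  simp only [hF, Option.elim]
  rw [hPt]
  have hRf : (R ! : ℂ) ≠ 0 := by exact_mod_cast Nat.factorial_ne_zero _
  rw [mul_pow, pow_succ]
  field_simp
  ring

/-- Exact formula for the depth-one B-elliptic multiple zeta value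
`B(n,0,…,0;τ) = τⁿ ∫₀¹ ((2πit)^{r−1}/(r−1)!) ω_n(τt,τ) dt` (with `r−1` zeros) in terms of
zeta values and iterated primitives of Eisenstein series. -/
theorem Bell_depth_one_formula (n r : ℕ) (hn : 2 ≤ n) (hr : 1 ≤ r)
    (τ : ℂ) (hτ : 0 < τ.im) :
    (τ ^ n * ∫ t in Set.Ioo (0 : ℝ) 1,
        ((2 * ↑π * Complex.I * ((t : ℝ) : ℂ)) ^ (r - 1) / ((r - 1)! : ℂ)) *
          omKr n (τ * ((t : ℝ) : ℂ)) τ) =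
      ((2 * ↑π * Complex.I) ^ r * τ ^ n / ((r - 1)! : ℂ)) *
          ∑ k ∈ Finset.range (n + 1),
            (bernoulli k : ℂ) / ((k ! : ℂ) * ((n - k)! : ℂ) * ((n - k + r : ℕ) : ℂ)) -
        ∑ p ∈ Finset.range (r - 1),
          (1 / ((r - 1 - p)! : ℂ)) * ((n + p - 1).choose p : ℂ) *
            (2 * ↑π * Complex.I) ^ ((r : ℤ) - (n : ℤ) - (p : ℤ)) *
            riemannZeta ((n + p : ℕ) : ℂ) * τ ^ (-(p : ℤ)) -
        (1 + (-1 : ℂ) ^ (n + r - 1)) * ((n + r - 2).choose (r - 1) : ℂ) *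
          (2 * ↑π * Complex.I) ^ (1 - (n : ℤ)) * riemannZeta ((n + r - 1 : ℕ) : ℂ) *
          τ ^ (1 - (r : ℤ)) +
        ((2 * ↑π * Complex.I) ^ (r - 1) / ((n - 1)! : ℂ)) *
          ∑ j ∈ Finset.Icc 1 (r - 1),
            (((n + j - 1)! : ℂ) / ((r - j)! : ℂ)) *
              ∑ i ∈ Finset.range j,
                ((-1 : ℂ) ^ (j - i - 1) * ((n + i - 1)! : ℂ) /
                    ((i ! : ℂ) * ((j - i - 1)! : ℂ))) *
                  ∑ k ∈ Finset.Icc 1 (n + i),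
                    ((-1 : ℂ) ^ (k - 1) * (2 * ↑π * Complex.I) ^ (1 - (k : ℤ)) *
                        τ ^ ((n : ℤ) - (k : ℤ)) / ((n + i - k)! : ℂ)) *
                      GammaEis (n + j) k τ := by
  obtain ⟨N, rfl⟩ : ∃ N, n = N + 1 := ⟨n - 1, by omega⟩
  obtain ⟨R, rfl⟩ : ∃ R, r = R + 1 := ⟨r - 1, by omega⟩
  have hN : 1 ≤ N := by omega
  have hI : (2 * π * Complex.I : ℂ) ≠ 0 := Complex.two_pi_I_ne_zero
  have hτ0 : τ ≠ 0 := by rintro rfl; simp at hτ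
  have hf : ∀ k, (k ! : ℂ) ≠ 0 := fun k => by exact_mod_cast Nat.factorial_ne_zero _
  have hc : 0 < (-(2 * π * Complex.I * τ)).re := by
    have : (-(2 * π * Complex.I * τ)).re = 2 * π * τ.im := by simp
    rw [this]; positivity
  have hzeta : ∀ j ∈ range R, 1 / ((R - j)! : ℂ) * ((N + j).choose j : ℂ) *
      (2 * π * Complex.I) ^ (((R + 1 : ℕ) : ℤ) - ((N + 1 : ℕ) : ℤ) - (j : ℤ)) *
      riemannZeta ((N + 1 + j : ℕ) : ℂ) * τ ^ (-(j : ℤ)) =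
      τ ^ (N + 1) * ((2 * π * Complex.I) ^ (R + 1) / (R ! : ℂ)) / N ! *
        (((j + N).choose j : ℂ) * (N ! : ℂ) *
        ((R.descFactorial j : ℂ) * (0 ^ (R - j) + (-1) ^ (N + 1 + j))) /
          (-(2 * π * Complex.I * τ)) ^ (j + N + 1) * riemannZeta ((j + N + 1 : ℕ) : ℂ)) := by
    intro j hj
    have hj : j < R := by simpa using hj
    have e1 : (R.descFactorial j : ℂ) = R ! / (R - j)! := by
      rw [eq_div_iff (hf _), mul_comm]
      exact_mod_cast Nat.factorial_mul_descFactorial hj.le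
    have e2 : N + 1 + j = j + N + 1 := by ring
    rw [e1, e2, zero_pow (by omega), zero_add, neg_pow (_ * τ), zpow_sub₀ hI, zpow_sub₀ hI,
      zpow_neg, zpow_natCast, zpow_natCast, zpow_natCast, zpow_natCast, add_comm N j,
      mul_pow (2 * π * Complex.I : ℂ) τ]
    have := hf R
    have := hf (R - j)
    have := hf N
    have h1 : ((-1 : ℂ)) ^ (j + N + 1) ≠ 0 := by simp
    generalize (2 * π * Complex.I : ℂ) = w at *
    generalize riemannZeta _ = z
    field_simp
    ring
  have hzetaR : (1 + (-1 : ℂ) ^ (N + 1 + R)) * ((N + R).choose R : ℂ) *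
      (2 * π * Complex.I) ^ (1 - ((N + 1 : ℕ) : ℤ)) * riemannZeta ((N + 1 + R : ℕ) : ℂ) *
      τ ^ (1 - ((R + 1 : ℕ) : ℤ)) =
      τ ^ (N + 1) * ((2 * π * Complex.I) ^ (R + 1) / (R ! : ℂ)) / N ! *
        (((R + N).choose R : ℂ) * (N ! : ℂ) *
        ((R.descFactorial R : ℂ) * (0 ^ (R - R) + (-1) ^ (N + 1 + R))) /
          (-(2 * π * Complex.I * τ)) ^ (R + N + 1) * riemannZeta ((R + N + 1 : ℕ) : ℂ)) := by
    have e2 : N + 1 + R = R + N + 1 := by ring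
    have e3 : (1 + (-1 : ℂ) ^ (R + N + 1)) * (-1 : ℂ) ^ (R + N + 1) =
        1 + (-1 : ℂ) ^ (R + N + 1) := by
      rcases neg_one_pow_eq_or ℂ (R + N + 1) with h | h <;> simp [h]
    rw [e2, Nat.descFactorial_self, Nat.sub_self, pow_zero, neg_pow (_ * τ), zpow_sub₀ hI,
      zpow_sub₀ hτ0, zpow_one, zpow_one, zpow_natCast, zpow_natCast, add_comm N R,
      mul_pow (2 * π * Complex.I : ℂ) τ]
    have := hf R
    have := hf N
    have h1 : ((-1 : ℂ)) ^ (R + N + 1) ≠ 0 := by simp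
    generalize (2 * π * Complex.I : ℂ) = w at *
    generalize riemannZeta _ = z
    generalize (-1 : ℂ) ^ (R + N + 1) = ε at *
    field_simp
    linear_combination (((R + N).choose R : ℂ) * w * z * τ * w ^ (R + N + 1) *
      τ ^ (R + N + 1)) * e3
  have hGamma : ∀ j ∈ range R, ((2 * π * Complex.I) ^ R / (N ! : ℂ)) *
      (((N + j + 1)! : ℂ) / ((R - j)! : ℂ) *
        ∑ i ∈ range (j + 1), ((-1 : ℂ) ^ (j - i) * ((N + i)! : ℂ) / ((i ! : ℂ) * ((j - i)! : ℂ))) *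
          ∑ k ∈ Icc 1 (N + i + 1), ((-1 : ℂ) ^ (k - 1) * (2 * π * Complex.I) ^ (1 - (k : ℤ)) *
            τ ^ (((N + 1 : ℕ) : ℤ) - (k : ℤ)) * GammaEis (N + j + 2) k τ) /
              ((N + i + 1 - k)! : ℂ)) =
      -(τ ^ (N + 1) * ((2 * π * Complex.I) ^ (R + 1) / (R ! : ℂ)) / N ! *
        ∑ s ∈ range (N + 1), ((j + s).choose j : ℂ) * (N.descFactorial s : ℂ) *
        ((R.descFactorial j : ℂ) * (-1 + (-1) ^ (N + 1 + j))) /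
          (-(2 * π * Complex.I * τ)) ^ (j + s + 1) *
          expLatticeSum (-(2 * π * Complex.I * τ)) (N - s) (j + s + 1)) := by
    intro j hj
    have hj : j < R := by simpa using hj
    rw [sum_alternating_factorial_mul_sum_Icc N j (fun k => (-1 : ℂ) ^ (k - 1) *
      (2 * π * Complex.I) ^ (1 - (k : ℤ)) * τ ^ (((N + 1 : ℕ) : ℤ) - (k : ℤ)) *
      GammaEis (N + j + 2) k τ), mul_sum, mul_sum, mul_sum, ← sum_neg_distrib]
    refine sum_congr rfl fun s hs => ?_
    have hs : s ≤ N := by simp at hs; omega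
    have e1 : (R.descFactorial j : ℂ) = R ! / (R - j)! := by
      rw [eq_div_iff (hf _), mul_comm]
      exact_mod_cast Nat.factorial_mul_descFactorial hj.le
    have e2 : (-1 : ℂ) ^ (N + 1 + j) = -(-1) ^ (N + j) := by ring
    have e3 : (-1 : ℂ) ^ (j + s + 1) = -(-1) ^ (j + s) := by ring
    have e4 : ((-1 : ℂ) ^ (j + s)) ^ 2 = 1 := by rw [← pow_mul, mul_comm, pow_mul]; simp
    rw [GammaEis_eq_expLatticeSum N j s hs, e1, e2, neg_pow (_ * τ), e3, zpow_sub₀ hI,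
      zpow_sub₀ hτ0, zpow_one, zpow_natCast, zpow_natCast, zpow_natCast, Nat.add_sub_cancel,
      mul_pow (2 * π * Complex.I : ℂ) τ]
    have := hf R
    have := hf N
    have := hf (R - j)
    have := hf (N + j + 1)
    have h1 : (-1 : ℂ) ^ (j + s) ≠ 0 := by simp
    generalize expLatticeSum _ _ _ = L
    generalize (2 * π * Complex.I : ℂ) = w at *
    generalize (-1 : ℂ) ^ (j + s) = ε at *
    generalize (-1 : ℂ) ^ (N + j) = δ at *
    field_simp
    rw [e4]
    ring
  simp only [Nat.add_sub_cancel]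
  rw [integral_pow_mul_omKr N R hN hτ (hasSum_integral_lattice_symm hN R hc)]
  have t1 : N + 1 + (R + 1) - 1 = N + 1 + R := by omega
  have t2 : N + 1 + (R + 1) - 2 = N + R := by omega
  have t3 : ∀ p, N + 1 + p - 1 = N + p := fun p => by omega
  have t4 : ∀ j, N + 1 + (1 + j) - 1 = N + j + 1 := fun j => by omega
  have t5 : ∀ j, R + 1 - (1 + j) = R - j := fun j => by omega
  have t6 : ∀ i j, 1 + j - i - 1 = j - i := fun i j => by omega
  have t7 : ∀ i, N + 1 + i = N + i + 1 := fun i => by omega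
  have t8 : ∀ j, N + 1 + (1 + j) = N + j + 2 := fun j => by omega
  have hΓ : ∀ j ∈ range R, ((2 * π * Complex.I) ^ R / (N ! : ℂ)) *
      (((N + 1 + (1 + j) - 1)! : ℂ) / ((R + 1 - (1 + j))! : ℂ) *
        ∑ i ∈ range (1 + j), ((-1 : ℂ) ^ (1 + j - i - 1) * ((N + 1 + i - 1)! : ℂ) /
          ((i ! : ℂ) * ((1 + j - i - 1)! : ℂ))) *
          ∑ k ∈ Icc 1 (N + 1 + i), ((-1 : ℂ) ^ (k - 1) * (2 * π * Complex.I) ^ (1 - (k : ℤ)) *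
            τ ^ (((N + 1 : ℕ) : ℤ) - (k : ℤ)) / ((N + 1 + i - k)! : ℂ)) *
              GammaEis (N + 1 + (1 + j)) k τ) = _ := fun j hj => by
    simp only [t4, t5, t6]
    simp only [t3, t8]
    simp only [t7, div_mul_eq_mul_div _ _ (GammaEis _ _ _), add_comm 1 j]
    exact hGamma j hj
  rw [t1, t2, hzetaR, ← Finset.Ico_add_one_right_eq_Icc, Finset.sum_Ico_eq_sum_range,
    Nat.add_sub_cancel, mul_sum (range R) _ ((2 * π * Complex.I) ^ R / (N ! : ℂ)),
    sum_congr rfl hΓ]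
  simp only [t3]
  rw [sum_congr rfl hzeta, sum_neg_distrib, ← mul_sum, ← mul_sum, sum_range_succ _ R]
  ring
end

section
/- For all integers n ≥ 1 and r ≥ 0, the polynomial identity Σ_{k=0}^{n−1} ((−1)^{n−k}/(k!·(n−k−1)!)) · Σ_{j=0}^{k+r} ((k+r)!/(k+r−j)!) · X^{j+1} = −Σ_{p=0}^{r} binom(r,p) · ((n+p−1)!/(n−1)!) · X^{n+p} holds in ℚ[X] (equivalently, it holds for every X in any commutative ℚ-algebra). -/
open scoped Nat
open Polynomial Finset

/-- The binomial transform `∑ₚ binom(r,p) · (m+p)! · X^{m+p+1}`, as a function of `r`. -/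
noncomputable def binomialFactorialSum (m r : ℕ) : ℚ[X] :=
  ∑ p ∈ Finset.range (r + 1), C ((r.choose p : ℚ) * ((m + p)! : ℚ)) * X ^ (m + p + 1)

theorem fwdDiff_binomialFactorialSum (m : ℕ) :
    fwdDiff 1 (binomialFactorialSum m) = binomialFactorialSum (m + 1) := by
  funext r
  have extend : binomialFactorialSum m r =
      ∑ p ∈ Finset.range (r + 2), C ((r.choose p : ℚ) * ((m + p)! : ℚ)) * X ^ (m + p + 1) := by
    rw [Finset.sum_range_succ _ (r + 1)]
    simp [binomialFactorialSum]
  rw [fwdDiff, extend, binomialFactorialSum, binomialFactorialSum, ← Finset.sum_sub_distrib,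
    Finset.sum_range_succ']
  simp only [Nat.choose_zero_right, sub_self, add_zero]
  refine Finset.sum_congr rfl fun p _ => ?_
  rw [Nat.choose_succ_succ', show m + (p + 1) = m + 1 + p by ring, ← sub_mul, ← C_sub]
  push_cast
  ring_nf

theorem fwdDiff_iter_binomialFactorialSum (m : ℕ) :
    (fwdDiff 1)^[m] (binomialFactorialSum 0) = binomialFactorialSum m := by
  induction m with
  | zero => rfl
  | succ m ih => rw [Function.iterate_succ_apply', ih, fwdDiff_binomialFactorialSum]

theorem sum_factorial_div_eq_binomialFactorialSum (N : ℕ) :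
    ∑ j ∈ Finset.range (N + 1), C ((N ! : ℚ) / ((N - j)! : ℚ)) * X ^ (j + 1) =
      binomialFactorialSum 0 N := by
  refine Finset.sum_congr rfl fun j hj => ?_
  rw [Nat.cast_choose ℚ (Finset.mem_range_succ_iff.mp hj), zero_add]
  congr 2
  field_simp

/-- The key combinatorial polynomial identity in `ℚ[X]` used to evaluate the
Laurent-polynomial parts of depth-one B-elliptic multiple zeta values:
`Σ_{k=0}^{n−1} ((−1)^{n−k}/(k!·(n−k−1)!)) · Σ_{j=0}^{k+r} ((k+r)!/(k+r−j)!) · X^{j+1}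
  = −Σ_{p=0}^{r} binom(r,p) · ((n+p−1)!/(n−1)!) · X^{n+p}`. -/
theorem depth_one_polynomial_identity (n r : ℕ) (hn : 1 ≤ n) :
    (∑ k ∈ Finset.range n,
        Polynomial.C ((-1 : ℚ) ^ (n - k) / ((k ! : ℚ) * ((n - k - 1)! : ℚ))) *
          ∑ j ∈ Finset.range (k + r + 1),
            Polynomial.C (((k + r)! : ℚ) / (((k + r - j)! : ℕ) : ℚ)) *
              Polynomial.X ^ (j + 1)) =
      - ∑ p ∈ Finset.range (r + 1),
          Polynomial.C ((r.choose p : ℚ) * (((n + p - 1)! : ℕ) : ℚ) / (((n - 1)! : ℕ) : ℚ)) *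
            (Polynomial.X : Polynomial ℚ) ^ (n + p) := by
  obtain ⟨m, rfl⟩ := Nat.exists_eq_add_of_le' hn
  have hm : (m ! : ℚ) ≠ 0 := by positivity
  have key := congrFun (fwdDiff_iter_binomialFactorialSum m) r
  rw [fwdDiff_iter_eq_sum_shift] at key
  have lhs : ∀ k ∈ Finset.range (m + 1),
      C ((-1 : ℚ) ^ (m + 1 - k) / ((k ! : ℚ) * ((m + 1 - k - 1)! : ℚ))) *
          ∑ j ∈ Finset.range (k + r + 1),
            C (((k + r)! : ℚ) / (((k + r - j)! : ℕ) : ℚ)) * X ^ (j + 1) =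
        C (-(m ! : ℚ)⁻¹) *
          (((-1 : ℤ) ^ (m - k) * m.choose k) • binomialFactorialSum 0 (r + k • 1)) := by
    intro k hk
    have hkm := Finset.mem_range_succ_iff.mp hk
    rw [sum_factorial_div_eq_binomialFactorialSum, zsmul_eq_mul, ← mul_assoc, smul_eq_mul,
      mul_one, add_comm r k, show m + 1 - k - 1 = m - k by omega,
      show m + 1 - k = m - k + 1 by omega, ← map_intCast (C : ℚ →+* ℚ[X]), ← C_mul]
    congr 2
    push_cast
    rw [Nat.cast_choose ℚ hkm]
    field_simp
    ring
  rw [Finset.sum_congr rfl lhs, ← Finset.mul_sum, key, binomialFactorialSum, C_neg, neg_mul,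
    Finset.mul_sum]
  congr 1
  refine Finset.sum_congr rfl fun p _ => ?_
  rw [← mul_assoc, ← C_mul, show m + 1 + p - 1 = m + p by omega, Nat.add_sub_cancel,
    add_right_comm m 1 p, div_eq_inv_mul]
end
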